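/- Let Δ be a countably infinite structure with finite relational signature that is ordered, homogeneous, Ramsey, and finitely bounded, and let Γ be a reduct of Δ with finite relational signature. Then the problems Expr_ex(Γ) and Expr_ep(Γ) are decidable. -/

import Mathlib

open FirstOrder FirstOrder.Language

namespace PaperDef

/-- The structure `M` is *ordered*: some binary relation symbol of the signature
denotes a linear order on the domain. -/
def Ordered (L : Language) (M : Type*) [L.Structure M] : Prop :=
  ∃ r : L.Relations 2, IsLinearOrder M (fun a b => Structure.RelMap r ![a, b])

/-- A class of structures is a *Ramsey class*. -/
def RamseyClass {L : Language} (K : Set (CategoryTheory.Bundled.{0} L.Structure)) : Prop :=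
  ∀ k : ℕ, 1 ≤ k → ∀ H ∈ K, ∀ P ∈ K, ∃ S ∈ K,
    ∀ χ : {Q : L.Substructure S // Nonempty (P ≃[L] Q)} → Fin k,
      ∃ e : H ↪[L] S,
        ∀ Q₁ Q₂ : {Q : L.Substructure S // Nonempty (P ≃[L] Q)},
          (Q₁.1 : Set S) ⊆ Set.range e → (Q₂.1 : Set S) ⊆ Set.range e → χ Q₁ = χ Q₂

/-- `M` is *finitely bounded*: membership of a finite(ly generated) structure in the age of `M`
is characterized by finitely many forbidden substructures. -/
def FinitelyBounded (L : Language) (M : Type) [L.Structure M] : Prop :=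
  ∃ (k : ℕ) (F : Fin k → CategoryTheory.Bundled.{0} L.Structure),
    (∀ i, Structure.FG L (F i)) ∧
    ∀ A : CategoryTheory.Bundled.{0} L.Structure, Structure.FG L A →
      (A ∈ L.age M ↔ ∀ i, ¬ Nonempty ((F i) ↪[L] A))

/-- The `L'`-structure on `M` is a *reduct* of the `L`-structure on `M`:
every relation of the former is first-order definable in the latter. -/
def IsReduct (L L' : Language) (M : Type*) [L.Structure M] [L'.Structure M] : Prop :=
  ∀ (n : ℕ) (r : L'.Relations n), ∃ φ : L.Formula (Fin n),
    ∀ x : Fin n → M, Structure.RelMap r x ↔ φ.Realize x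

/-- Two `n`-tuples have the same (complete first-order) type. -/
def SameType (L : Language) (M : Type*) [L.Structure M] {n : ℕ} (a b : Fin n → M) : Prop :=
  ∀ φ : L.Formula (Fin n), φ.Realize a ↔ φ.Realize b

/-- A function is *canonical*: it maps tuples of equal types to tuples of equal types. -/
def Canonical (L L' : Language) (X Ω : Type*) [L.Structure X] [L'.Structure Ω]
    (f : X → Ω) : Prop :=
  ∀ (n : ℕ) (a b : Fin n → X), SameType L X a b →
    SameType L' Ω (fun i => f (a i)) (fun i => f (b i))

/-- A function is *canonical on a set `F`*. -/
def CanonicalOn (L L' : Language) (X Ω : Type*) [L.Structure X] [L'.Structure Ω]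
    (F : Set X) (f : X → Ω) : Prop :=
  ∀ (n : ℕ) (a b : Fin n → X), (∀ i, a i ∈ F) → (∀ i, b i ∈ F) → SameType L X a b →
    SameType L' Ω (fun i => f (a i)) (fun i => f (b i))

/-- `M` is ω-categorical: every countable model of its complete theory is isomorphic to it. -/
def OmegaCategorical (L : Language) (M : Type) [L.Structure M] : Prop :=
  ∀ (N : Type) [L.Structure N], Countable N →
    (∀ φ : L.Sentence, φ ∈ L.completeTheory M → N ⊨ φ) → Nonempty (M ≃[L] N)

/-- Primitive positive formulas: built from atomic formulas using `∧` and `∃`. -/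
inductive IsPrimitivePositive {L : Language} {α : Type*} :
    ∀ {n : ℕ}, L.BoundedFormula α n → Prop
  | atomic {n : ℕ} {φ : L.BoundedFormula α n} (h : φ.IsAtomic) : IsPrimitivePositive φ
  | inf {n : ℕ} {φ ψ : L.BoundedFormula α n} :
      IsPrimitivePositive φ → IsPrimitivePositive ψ → IsPrimitivePositive (φ ⊓ ψ)
  | ex {n : ℕ} {φ : L.BoundedFormula α (n + 1)} :
      IsPrimitivePositive φ → IsPrimitivePositive φ.ex

/-- Existential formulas: existentially quantified quantifier-free formulas. -/
inductive IsExistential {L : Language} {α : Type*} :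
    ∀ {n : ℕ}, L.BoundedFormula α n → Prop
  | of_isQF {n : ℕ} {φ : L.BoundedFormula α n} (h : φ.IsQF) : IsExistential φ
  | ex {n : ℕ} {φ : L.BoundedFormula α (n + 1)} : IsExistential φ → IsExistential φ.ex

/-- Existential positive formulas: built from atomic formulas using `∧`, `∨` and `∃`. -/
inductive IsExistentialPositive {L : Language} {α : Type*} :
    ∀ {n : ℕ}, L.BoundedFormula α n → Prop
  | atomic {n : ℕ} {φ : L.BoundedFormula α n} (h : φ.IsAtomic) : IsExistentialPositive φ
  | inf {n : ℕ} {φ ψ : L.BoundedFormula α n} :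
      IsExistentialPositive φ → IsExistentialPositive ψ → IsExistentialPositive (φ ⊓ ψ)
  | sup {n : ℕ} {φ ψ : L.BoundedFormula α n} :
      IsExistentialPositive φ → IsExistentialPositive ψ → IsExistentialPositive (φ ⊔ ψ)
  | ex {n : ℕ} {φ : L.BoundedFormula α (n + 1)} :
      IsExistentialPositive φ → IsExistentialPositive φ.ex

/-- A `k`-ary operation *preserves* an `m`-ary relation. -/
def Preserves {D : Type*} {k m : ℕ} (f : (Fin k → D) → D) (R : (Fin m → D) → Prop) : Prop :=
  ∀ rows : Fin k → Fin m → D, (∀ j, R (rows j)) → R (fun i => f (fun j => rows j i))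

/-- A unary operation *preserves* an `m`-ary relation. -/
def Preserves1 {D : Type*} {m : ℕ} (f : D → D) (R : (Fin m → D) → Prop) : Prop :=
  ∀ a : Fin m → D, R a → R (fun i => f (a i))

/-- An endomorphism of the structure `M`. -/
def IsEndo (L : Language) (M : Type*) [L.Structure M] (f : M → M) : Prop :=
  ∀ (n : ℕ) (r : L.Relations n) (x : Fin n → M),
    Structure.RelMap r x → Structure.RelMap r (fun i => f (x i))

/-- A self-embedding of the structure `M`. -/
def IsSelfEmb (L : Language) (M : Type*) [L.Structure M] (f : M → M) : Prop :=
  Function.Injective f ∧ ∀ (n : ℕ) (r : L.Relations n) (x : Fin n → M),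
    (Structure.RelMap r (fun i => f (x i)) ↔ Structure.RelMap r x)

/-- A polymorphism of the structure `M`. -/
def IsPoly (L : Language) (M : Type*) [L.Structure M] {k : ℕ} (f : (Fin k → M) → M) : Prop :=
  ∀ (n : ℕ) (r : L.Relations n), Preserves f (fun x : Fin n → M => Structure.RelMap r x)

/-- The set of endomorphisms of `M`. -/
def EndSet (L : Language) (M : Type*) [L.Structure M] : Set (M → M) :=
  {f | IsEndo L M f}

/-- Two tuples lie in the same orbit of the automorphism group. -/
def SameOrbit (L : Language) (M : Type*) [L.Structure M] {n : ℕ} (a b : Fin n → M) : Prop :=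
  ∃ α : M ≃[L] M, ∀ i, α (a i) = b i

/-- The subsets `s` and `t` induce isomorphic substructures. -/
def SetIso (L : Language) (X : Type*) [L.Structure X] (s t : Set X) : Prop :=
  ∃ g : s ≃ t, ∀ (n : ℕ) (r : L.Relations n) (x : Fin n → s),
    (Structure.RelMap r (fun j => ((x j : X))) ↔ Structure.RelMap r (fun j => ((g (x j) : t) : X)))

/-- The `L[[Fin n]]`-structure on `M` obtained by naming the constants `c 0, …, c (n-1)`. -/
def withConstantsStruct (L : Language) {M : Type*} [L.Structure M] {n : ℕ} (c : Fin n → M) :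
    (L[[Fin n]]).Structure M :=
  letI := constantsOn.structure c
  inferInstance

/-- Two sequences of `n` tuples from a product `Ξ₁ × ⋯ × Ξₘ` have the same type:
componentwise, the corresponding `n`-tuples have the same type. -/
def SameSeqType {m : ℕ} (Ls : Fin m → Language) (Xs : Fin m → Type*)
    [∀ i, (Ls i).Structure (Xs i)] {n : ℕ} (a b : Fin n → ∀ i, Xs i) : Prop :=
  ∀ i, SameType (Ls i) (Xs i) (fun j => a j i) (fun j => b j i)

/-- A function defined on a product of structures is canonical. -/
def CanonicalProd {m : ℕ} (Ls : Fin m → Language) (Xs : Fin m → Type*)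
    [∀ i, (Ls i).Structure (Xs i)] (L' : Language) (Ω : Type*) [L'.Structure Ω]
    (f : (∀ i, Xs i) → Ω) : Prop :=
  ∀ (n : ℕ) (a b : Fin n → ∀ i, Xs i), SameSeqType Ls Xs a b →
    SameType L' Ω (fun j => f (a j)) (fun j => f (b j))

end PaperDef

namespace PaperDef

open Computability

/-- An `Encodable` instance for bounded formulas, via `BoundedFormula.listEncode`. -/
instance instEncodableSigmaBoundedFormula (L : Language) (α : Type*) [Encodable α]
    [∀ i, Encodable (L.Functions i)] [∀ i, Encodable (L.Relations i)] :
    Encodable (Σ n, L.BoundedFormula α n) :=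
  Encodable.ofLeftInjection (fun φ => φ.2.listEncode)
    (fun l => (BoundedFormula.listDecode l).head?)
    (fun φ => by
      have h := BoundedFormula.listDecode_encode_list (L := L) (α := α) [φ]
      rw [List.flatMap_singleton] at h
      show (BoundedFormula.listDecode φ.2.listEncode).head? = some φ
      rw [h]
      rfl)

/-- An `Encodable` instance for formulas. -/
instance instEncodableFormula (L : Language) (α : Type*) [Encodable α]
    [∀ i, Encodable (L.Functions i)] [∀ i, Encodable (L.Relations i)] :
    Encodable (L.Formula α) :=
  Encodable.ofLeftInjection
    (fun φ => (⟨0, φ⟩ : Σ n, L.BoundedFormula α n))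
    (fun q => match q with
      | ⟨0, φ⟩ => some φ
      | ⟨_ + 1, _⟩ => none)
    (fun _ => rfl)

/-- A formula together with the number of its free variables.  A (quantifier-free) formula
`φᵢ` as in the input of the problems `Expr_pp`, `Expr_ex`, `Expr_ep`. -/
abbrev FormulaCode (L : Language) : Type _ :=
  (m : ℕ) × L.Formula (Fin m)

/-- The signature with one relation symbol for each formula in the list `l`,
of the corresponding arity. -/
def sigOf {L : Language} (l : List (FormulaCode L)) : Language :=
  ⟨fun _ => Empty, fun n => {i : Fin l.length // (l.get i).1 = n}⟩

/-- The structure `(D; R₁, …, Rₙ)` on the domain of `M` whose relations are defined by the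
formulas in the list `l`. -/
def structOf {L : Language} (M : Type*) [L.Structure M] (l : List (FormulaCode L)) :
    (sigOf l).Structure M where
  funMap := fun f _ => f.elim
  RelMap := fun r x => (l.get r.1).2.Realize (fun v => x (Fin.cast r.2 v))

/-- The relation defined by `φ₀` over `M` is primitive positive definable in the structure
whose relations are defined by the formulas in `l`. -/
def ExprYesPP {L : Language} (M : Type*) [L.Structure M]
    (φ₀ : FormulaCode L) (l : List (FormulaCode L)) : Prop :=
  letI := structOf M l
  ∃ ψ : (sigOf l).Formula (Fin φ₀.1), IsPrimitivePositive ψ ∧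
    ∀ x : Fin φ₀.1 → M, φ₀.2.Realize x ↔ ψ.Realize x

/-- The relation defined by `φ₀` over `M` is existentially definable in the structure
whose relations are defined by the formulas in `l`. -/
def ExprYesEx {L : Language} (M : Type*) [L.Structure M]
    (φ₀ : FormulaCode L) (l : List (FormulaCode L)) : Prop :=
  letI := structOf M l
  ∃ ψ : (sigOf l).Formula (Fin φ₀.1), IsExistential ψ ∧
    ∀ x : Fin φ₀.1 → M, φ₀.2.Realize x ↔ ψ.Realize x

/-- The relation defined by `φ₀` over `M` is existentially positively definable in the
structure whose relations are defined by the formulas in `l`. -/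
def ExprYesEP {L : Language} (M : Type*) [L.Structure M]
    (φ₀ : FormulaCode L) (l : List (FormulaCode L)) : Prop :=
  letI := structOf M l
  ∃ ψ : (sigOf l).Formula (Fin φ₀.1), IsExistentialPositive ψ ∧
    ∀ x : Fin φ₀.1 → M, φ₀.2.Realize x ↔ ψ.Realize x

/-- Decidability of the problem `Expr_pp(Γ)`: there is a computable function on codes which,
for every input consisting of quantifier-free formulas `φ₀` and `φ₁, …, φₙ`, decides whether
the relation defined by `φ₀` is primitive positive definable from the relations defined by
`φ₁, …, φₙ`. -/
def DecidableExprPP (L : Language) (M : Type*) [L.Structure M] [∀ i, Encodable (L.Functions i)]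
    [∀ i, Encodable (L.Relations i)] : Prop :=
  ∃ f : ℕ → Bool, Computable f ∧
    ∀ (φ₀ : FormulaCode L) (l : List (FormulaCode L)),
      BoundedFormula.IsQF φ₀.2 → (∀ p ∈ l, BoundedFormula.IsQF p.2) →
      (f (Encodable.encode (φ₀, l)) = true ↔ ExprYesPP M φ₀ l)

/-- Decidability of the problem `Expr_ex(Γ)`. -/
def DecidableExprEx (L : Language) (M : Type*) [L.Structure M] [∀ i, Encodable (L.Functions i)]
    [∀ i, Encodable (L.Relations i)] : Prop :=
  ∃ f : ℕ → Bool, Computable f ∧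
    ∀ (φ₀ : FormulaCode L) (l : List (FormulaCode L)),
      BoundedFormula.IsQF φ₀.2 → (∀ p ∈ l, BoundedFormula.IsQF p.2) →
      (f (Encodable.encode (φ₀, l)) = true ↔ ExprYesEx M φ₀ l)

/-- Decidability of the problem `Expr_ep(Γ)`. -/
def DecidableExprEP (L : Language) (M : Type*) [L.Structure M] [∀ i, Encodable (L.Functions i)]
    [∀ i, Encodable (L.Relations i)] : Prop :=
  ∃ f : ℕ → Bool, Computable f ∧
    ∀ (φ₀ : FormulaCode L) (l : List (FormulaCode L)),
      BoundedFormula.IsQF φ₀.2 → (∀ p ∈ l, BoundedFormula.IsQF p.2) →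
      (f (Encodable.encode (φ₀, l)) = true ↔ ExprYesEP M φ₀ l)

end PaperDef

namespace ExprAux

section Lists

/-- all lists of length `k` with entries `< n` -/
def tuples (n : ℕ) : ℕ → List (List ℕ)
  | 0 => [ [] ]
  | k + 1 => (tuples n k).flatMap (fun t => (List.range n).map (fun d => d :: t))

theorem mem_tuples {n k : ℕ} {e : List ℕ} :
    e ∈ tuples n k ↔ e.length = k ∧ ∀ d ∈ e, d < n := by
  induction k generalizing e with
  | zero =>
    simp only [tuples, List.mem_singleton, List.length_eq_zero_iff]
    constructor
    · rintro rfl; simp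
    · exact fun h => h.1
  | succ k ih =>
    simp only [tuples, List.mem_flatMap, List.mem_map, List.mem_range]
    constructor
    · rintro ⟨t, ht, d, hd, rfl⟩
      rw [ih] at ht
      simp only [List.length_cons, ht.1, true_and, List.mem_cons]
      rintro x (rfl | hx)
      · exact hd
      · exact ht.2 x hx
    · rintro ⟨h1, h2⟩
      cases e with
      | nil => simp at h1
      | cons d t =>
        refine ⟨t, ih.2 ⟨by simpa using h1, fun x hx => h2 x (List.mem_cons_of_mem _ hx)⟩, d,
          h2 d List.mem_cons_self, rfl⟩

theorem getD_lt_of_mem_tuples {n k : ℕ} {e : List ℕ} (h : e ∈ tuples n k) {i : ℕ} (hi : i < k) :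
    e.getD i 0 < n := by
  rw [mem_tuples] at h
  obtain ⟨rfl, h2⟩ := h
  rw [List.getD_eq_getElem _ _ hi]
  exact h2 _ (List.getElem_mem _)

/-- application of a tabulated function -/
def app {X : Type*} [DecidableEq X] (dom : List X) (f : List ℕ) (x : X) : ℕ :=
  f.getD (dom.idxOf x) 0

theorem app_map {X : Type*} [DecidableEq X] {dom : List X} {F : X → ℕ} {x : X} (h : x ∈ dom) :
    app dom (dom.map F) x = F x := by
  have h1 : dom.idxOf x < dom.length := List.idxOf_lt_length_of_mem h
  rw [app, List.getD_eq_getElem _ _ (by simpa using h1), List.getElem_map, List.getElem_idxOf]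

theorem app_lt {X : Type*} [DecidableEq X] {dom : List X} {f : List ℕ} {C : ℕ} (hC : 0 < C)
    (hf : ∀ d ∈ f, d < C) (x : X) : app dom f x < C := by
  unfold app
  by_cases h : dom.idxOf x < f.length
  · rw [List.getD_eq_getElem _ _ h]; exact hf _ (List.getElem_mem _)
  · rw [List.getD_eq_default _ _ (not_lt.1 h)]; exact hC

theorem eq_map_app {X : Type*} [DecidableEq X] {dom : List X} {f : List ℕ} (hd : dom.Nodup)
    (hf : f.length = dom.length) : f = dom.map (app dom f) := by
  apply List.ext_getElem
  · simpa using hf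
  · intro i h1 h2
    have h3 : i < dom.length := by simpa using h2
    rw [List.getElem_map, app, List.Nodup.idxOf_getElem hd, List.getD_eq_getElem _ _ h1]

theorem nodup_tuples (n k : ℕ) : (tuples n k).Nodup := by
  induction k with
  | zero => simp [tuples]
  | succ k ih =>
    rw [tuples, List.nodup_flatMap]
    refine ⟨fun t _ => List.Nodup.map (fun a b h => by simpa using h) List.nodup_range, ?_⟩
    refine ih.imp ?_
    intro a b hab x hx hy
    simp only [List.mem_map] at hx hy
    obtain ⟨d, _, rfl⟩ := hx
    obtain ⟨d', _, h⟩ := hy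
    simp at h
    exact hab h.2.symm

/-- codes of potential types of `n`-tuples -/
def types (p C n : ℕ) : List (List ℕ) := tuples C (tuples n p).length

/-- pulling back a type on `n` elements along a map `g` from `m` to `n` -/
def tcomp (p n : ℕ) (ρ : List ℕ) (m : ℕ) (g : List ℕ) : List ℕ :=
  (tuples m p).map (fun w => app (tuples n p) ρ (w.map (fun d => g.getD d 0)))

def Valid (p : ℕ) (PT : List (List ℕ)) (n : ℕ) (ρ : List ℕ) : Prop :=
  ∀ w ∈ tuples n p, tcomp p n ρ p w ∈ PT

/-- the map from `k + m'` to `k + m` which is the identity on `k` and `w` on the rest -/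
def ext (k : ℕ) (w : List ℕ) : List ℕ := List.range k ++ w.map (fun d => k + d)

/-- the type of the image of an `m`-tuple under a behaviour -/
def Bm (p C k m : ℕ) (B ρ : List ℕ) : List ℕ :=
  (tuples m p).map (fun w => app (types p C (k + p)) B (tcomp p (k + m) ρ (k + p) (ext k w)))

def padl (p : ℕ) (l : List ℕ) : List ℕ := (List.range p).map (fun i => l.getD i 0)

/-- atomic tests -/
def tst (p : ℕ) (RT : List (ℕ × List ℕ)) (n : ℕ) (ρ : List ℕ) (e : ℕ) (l : List ℕ) : ℕ :=
  if (e, tcomp p n ρ p (padl p l)) ∈ RT then 1 else 0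

def popv (p : ℕ) (RT : List (ℕ × List ℕ)) (n : ℕ) (ρ : List ℕ) (s : List ℕ) : ℕ :=
  if s.getD 0 0 < 2 then s.getD 0 0 else tst p RT n ρ 0 [s.getD 0 0 - 2, s.getD 1 0 - 2]

def popr (s : List ℕ) : List ℕ := if s.getD 0 0 < 2 then s.drop 1 else s.drop 2

def vdec (c : ℕ) : ℕ := (Nat.unpair ((Nat.unpair (c / 2)).2 - 1)).1 / 4

def stepS (p : ℕ) (RT : List (ℕ × List ℕ)) (n : ℕ) (ρ : List ℕ) (c : ℕ)
    (s : List ℕ × List ℕ) : List ℕ :=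
  if c % 2 = 0 then (vdec c + 2) :: s.1
  else if c % 4 = 1 then
    tst p RT n ρ (c / 4 + 1) ((s.2.take (Nat.unpair (c / 4)).1).map (fun d => d - 2)) ::
      s.2.drop (Nat.unpair (c / 4)).1
  else if c = 3 then
    (if popv p RT n ρ s.1 = 1 ∧ popv p RT n ρ (popr s.1) ≠ 1 then 0 else 1) :: popr (popr s.1)
  else 0 :: s.1

def run (p : ℕ) (RT : List (ℕ × List ℕ)) (n : ℕ) (ρ : List ℕ) (tok : List ℕ) :
    List ℕ × List ℕ :=
  tok.foldr (fun c s => (stepS p RT n ρ c s, s.1)) ([], [])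

def Ev (p : ℕ) (RT : List (ℕ × List ℕ)) (n : ℕ) (ρ : List ℕ) (tok : List ℕ) : Prop :=
  popv p RT n ρ (run p RT n ρ tok).1 = 1

/-- the criterion for undefinability -/
def Crit (p C : ℕ) (PT : List (List ℕ)) (RT : List (ℕ × List ℕ))
    (x : (ℕ × List ℕ) × List (ℕ × List ℕ)) : Prop :=
  ∃ σ ∈ types p C x.1.1, Valid p PT x.1.1 σ ∧ Ev p RT x.1.1 σ x.1.2 ∧
    ∃ B ∈ tuples C (types p C (x.1.1 + p)).length,
      (∀ ρ ∈ types p C (x.1.1 + p), Valid p PT (x.1.1 + p) ρ →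
        tcomp p (x.1.1 + p) ρ x.1.1 (List.range x.1.1) = σ →
        Bm p C x.1.1 p B ρ ∈ PT) ∧
      (∀ q ∈ x.2, ∀ ρ ∈ types p C (x.1.1 + q.1), Valid p PT (x.1.1 + q.1) ρ →
        tcomp p (x.1.1 + q.1) ρ x.1.1 (List.range x.1.1) = σ →
        Ev p RT q.1 (tcomp p (x.1.1 + q.1) ρ q.1 ((List.range q.1).map (fun d => x.1.1 + d))) q.2 →
        Ev p RT q.1 (Bm p C x.1.1 q.1 B ρ) q.2) ∧
      ¬ Ev p RT x.1.1 (Bm p C x.1.1 x.1.1 B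
        (tcomp p x.1.1 σ (x.1.1 + x.1.1) (List.range x.1.1 ++ List.range x.1.1))) x.1.2

/-- the relation `R₀` is nonempty -/
def NonemptyC (p C : ℕ) (PT : List (List ℕ)) (RT : List (ℕ × List ℕ))
    (x : (ℕ × List ℕ) × List (ℕ × List ℕ)) : Prop :=
  ∃ σ ∈ types p C x.1.1, Valid p PT x.1.1 σ ∧ Ev p RT x.1.1 σ x.1.2

/-- there is a constant tuple in all relations -/
def ConstC (p C : ℕ) (PT : List (List ℕ)) (RT : List (ℕ × List ℕ))
    (x : (ℕ × List ℕ) × List (ℕ × List ℕ)) : Prop :=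
  ∃ σ ∈ types p C 1, Valid p PT 1 σ ∧
    ∀ q ∈ x.2, Ev p RT q.1 (tcomp p 1 σ q.1 ((List.range q.1).map (fun _ => 0))) q.2

/-- passing from existential to existential positive instances -/
def trx (D : List ℕ) (x : (ℕ × List ℕ) × List (ℕ × List ℕ)) :
    (ℕ × List ℕ) × List (ℕ × List ℕ) :=
  (x.1, x.2 ++ (x.2.map (fun q => (q.1, 3 :: (q.2 ++ [11]))) ++ [(2, D)]))

end Lists

section Prim

variable {α β : Type*} [Primcodable α] [Primcodable β]

theorem prim_ex {f : α → List β} {P : α → β → Prop} (hf : Primrec f)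
    (hP : PrimrecPred (fun x : α × β => P x.1 x.2)) : PrimrecPred fun a => ∃ b ∈ f a, P a b := by
  have h : PrimrecRel (fun (b : β) (a : α) => P a b) :=
    PrimrecPred.comp hP (Primrec.pair Primrec.snd Primrec.fst)
  exact (h.exists_mem_list).comp hf Primrec.id

theorem prim_all {f : α → List β} {P : α → β → Prop} (hf : Primrec f)
    (hP : PrimrecPred (fun x : α × β => P x.1 x.2)) : PrimrecPred fun a => ∀ b ∈ f a, P a b := by
  have h : PrimrecRel (fun (b : β) (a : α) => P a b) :=
    PrimrecPred.comp hP (Primrec.pair Primrec.snd Primrec.fst)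
  exact (h.forall_mem_list).comp hf Primrec.id

theorem prim_imp {P Q : α → Prop} (hP : PrimrecPred P) (hQ : PrimrecPred Q) :
    PrimrecPred fun a => P a → Q a :=
  (hP.not.or hQ).of_eq fun a => by tauto

theorem prim_mem {f : α → β} (l : List β) (hf : Primrec f) : PrimrecPred fun a => f a ∈ l := by
  have : PrimrecPred fun a => ∃ b ∈ l, f a = b :=
    prim_ex (P := fun a b => f a = b) (Primrec.const l)
      (Primrec.eq.comp (hf.comp Primrec.fst) Primrec.snd)
  exact this.of_eq fun a => by simp

theorem prim_map {γ : Type*} [Primcodable γ] {f : α → List β} {g : α → β → γ} (hf : Primrec f)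
    (hg : Primrec fun x : α × β => g x.1 x.2) : Primrec fun a => (f a).map (g a) :=
  Primrec.list_map hf hg.to₂

theorem prim_tuples {n k : α → ℕ} (hn : Primrec n) (hk : Primrec k) :
    Primrec fun a => tuples (n a) (k a) := by
  have h1 : Primrec₂ (fun (n : ℕ) (x : ℕ × List (List ℕ)) =>
      x.2.flatMap (fun t => (List.range n).map (fun d => d :: t))) := by
    refine Primrec.list_flatMap (Primrec.snd.comp Primrec.snd) ?_
    refine Primrec.list_map (Primrec.list_range.comp (Primrec.fst.comp Primrec.fst)) ?_
    exact Primrec.list_cons.comp Primrec.snd (Primrec.snd.comp Primrec.fst)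
  have h2 : Primrec₂ (fun (n k : ℕ) => tuples n k) := by
    refine (Primrec.nat_rec (f := fun _ => [ [] ]) (Primrec.const [ [] ]) h1).of_eq ?_
    intro n k
    induction k with
    | zero => rfl
    | succ k ih => simp only [tuples] at ih ⊢; rw [← ih]
  exact h2.comp hn hk

theorem prim_app {γ : Type*} [Primcodable γ] [DecidableEq γ]
    {dom : α → List γ} {f : α → List ℕ} {x : α → γ}
    (h1 : Primrec dom) (h2 : Primrec f) (h3 : Primrec x) :
    Primrec fun a => app (dom a) (f a) (x a) :=
  (Primrec.list_getD 0).comp h2 (Primrec.list_idxOf.comp h3 h1)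

theorem prim_types (p C : ℕ) {n : α → ℕ} (hn : Primrec n) :
    Primrec fun a => types p C (n a) :=
  prim_tuples (Primrec.const C) (Primrec.list_length.comp (prim_tuples hn (Primrec.const p)))

theorem prim_tcomp (p : ℕ) {n m : α → ℕ} {ρ g : α → List ℕ} (hn : Primrec n) (hρ : Primrec ρ)
    (hm : Primrec m) (hg : Primrec g) : Primrec fun a => tcomp p (n a) (ρ a) (m a) (g a) := by
  refine prim_map (prim_tuples hm (Primrec.const p)) ?_
  refine prim_app (prim_tuples (hn.comp Primrec.fst) (Primrec.const p)) (hρ.comp Primrec.fst) ?_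
  refine prim_map Primrec.snd ?_
  exact (Primrec.list_getD 0).comp (hg.comp (Primrec.fst.comp Primrec.fst)) Primrec.snd

theorem prim_Valid (p : ℕ) (PT : List (List ℕ)) {n : α → ℕ} {ρ : α → List ℕ} (hn : Primrec n)
    (hρ : Primrec ρ) : PrimrecPred fun a => Valid p PT (n a) (ρ a) := by
  refine prim_all (P := fun a w => tcomp p (n a) (ρ a) p w ∈ PT)
    (prim_tuples hn (Primrec.const p)) (prim_mem PT ?_)
  exact prim_tcomp p (hn.comp Primrec.fst) (hρ.comp Primrec.fst) (Primrec.const p) Primrec.snd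

theorem prim_ext {k : α → ℕ} {w : α → List ℕ} (hk : Primrec k) (hw : Primrec w) :
    Primrec fun a => ext (k a) (w a) :=
  Primrec.list_append.comp (Primrec.list_range.comp hk)
    (prim_map hw (Primrec.nat_add.comp (hk.comp Primrec.fst) Primrec.snd))

theorem prim_Bm (p C : ℕ) {k m : α → ℕ} {B ρ : α → List ℕ} (hk : Primrec k) (hm : Primrec m)
    (hB : Primrec B) (hρ : Primrec ρ) : Primrec fun a => Bm p C (k a) (m a) (B a) (ρ a) := by
  refine prim_map (prim_tuples hm (Primrec.const p)) ?_
  have hk' := hk.comp (Primrec.fst (α := α) (β := List ℕ))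
  have hm' := hm.comp (Primrec.fst (α := α) (β := List ℕ))
  have hkp := Primrec.nat_add.comp hk' (Primrec.const p)
  exact prim_app (prim_types p C hkp) (hB.comp Primrec.fst)
    (prim_tcomp p (Primrec.nat_add.comp hk' hm') (hρ.comp Primrec.fst) hkp
      (prim_ext hk' Primrec.snd))

theorem prim_padl (p : ℕ) {l : α → List ℕ} (hl : Primrec l) : Primrec fun a => padl p (l a) :=
  prim_map (Primrec.const _) ((Primrec.list_getD 0).comp (hl.comp Primrec.fst) Primrec.snd)

theorem prim_tst (p : ℕ) (RT : List (ℕ × List ℕ)) {n e : α → ℕ} {ρ l : α → List ℕ}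
    (hn : Primrec n) (hρ : Primrec ρ) (he : Primrec e) (hl : Primrec l) :
    Primrec fun a => tst p RT (n a) (ρ a) (e a) (l a) :=
  Primrec.ite (prim_mem RT (Primrec.pair he (prim_tcomp p hn hρ (Primrec.const p)
    (prim_padl p hl)))) (Primrec.const 1) (Primrec.const 0)

theorem prim_popv (p : ℕ) (RT : List (ℕ × List ℕ)) {n : α → ℕ} {ρ s : α → List ℕ}
    (hn : Primrec n) (hρ : Primrec ρ) (hs : Primrec s) :
    Primrec fun a => popv p RT (n a) (ρ a) (s a) := by
  have h0 := (Primrec.list_getD 0).comp hs (Primrec.const 0)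
  have h1 := (Primrec.list_getD 0).comp hs (Primrec.const 1)
  refine Primrec.ite (Primrec.nat_lt.comp h0 (Primrec.const 2)) h0
    (prim_tst p RT hn hρ (Primrec.const 0) ?_)
  refine Primrec.list_cons.comp (Primrec.nat_sub.comp h0 (Primrec.const 2)) ?_
  exact Primrec.list_cons.comp (Primrec.nat_sub.comp h1 (Primrec.const 2)) (Primrec.const [])

theorem prim_popr {s : α → List ℕ} (hs : Primrec s) : Primrec fun a => popr (s a) :=
  Primrec.ite (Primrec.nat_lt.comp ((Primrec.list_getD 0).comp hs (Primrec.const 0))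
    (Primrec.const 2)) (Primrec.list_drop.comp (Primrec.const 1) hs)
    (Primrec.list_drop.comp (Primrec.const 2) hs)

theorem prim_vdec {c : α → ℕ} (hc : Primrec c) : Primrec fun a => vdec (c a) := by
  have h1 := Primrec.nat_div.comp hc (Primrec.const 2)
  have h2 := Primrec.snd.comp (Primrec.unpair.comp h1)
  have h3 := Primrec.fst.comp (Primrec.unpair.comp (Primrec.nat_sub.comp h2 (Primrec.const 1)))
  exact Primrec.nat_div.comp h3 (Primrec.const 4)

theorem prim_stepS (p : ℕ) (RT : List (ℕ × List ℕ)) {n c : α → ℕ} {ρ : α → List ℕ}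
    {s : α → List ℕ × List ℕ} (hn : Primrec n) (hρ : Primrec ρ) (hc : Primrec c)
    (hs : Primrec s) : Primrec fun a => stepS p RT (n a) (ρ a) (c a) (s a) := by
  have hs1 := Primrec.fst.comp hs
  have hs2 := Primrec.snd.comp hs
  have hc4 := Primrec.nat_div.comp hc (Primrec.const 4)
  have hr := Primrec.fst.comp (Primrec.unpair.comp hc4)
  refine Primrec.ite (Primrec.eq.comp (Primrec.nat_mod.comp hc (Primrec.const 2))
    (Primrec.const 0)) (Primrec.list_cons.comp
      (Primrec.nat_add.comp (prim_vdec hc) (Primrec.const 2)) hs1) ?_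
  refine Primrec.ite (Primrec.eq.comp (Primrec.nat_mod.comp hc (Primrec.const 4))
    (Primrec.const 1)) (Primrec.list_cons.comp (prim_tst p RT hn hρ
      (Primrec.nat_add.comp hc4 (Primrec.const 1)) ?_) (Primrec.list_drop.comp hr hs2)) ?_
  · exact prim_map (Primrec.list_take.comp hr hs2)
      (Primrec.nat_sub.comp Primrec.snd (Primrec.const 2))
  refine Primrec.ite (Primrec.eq.comp hc (Primrec.const 3)) (Primrec.list_cons.comp ?_
    (prim_popr (prim_popr hs1))) (Primrec.list_cons.comp (Primrec.const 0) hs1)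
  refine Primrec.ite ?_ (Primrec.const 0) (Primrec.const 1)
  exact (Primrec.eq.comp (prim_popv p RT hn hρ hs1) (Primrec.const 1)).and
    (Primrec.eq.comp (prim_popv p RT hn hρ (prim_popr hs1)) (Primrec.const 1)).not

theorem prim_Ev (p : ℕ) (RT : List (ℕ × List ℕ)) {n : α → ℕ} {ρ tok : α → List ℕ}
    (hn : Primrec n) (hρ : Primrec ρ) (ht : Primrec tok) :
    PrimrecPred fun a => Ev p RT (n a) (ρ a) (tok a) := by
  refine Primrec.eq.comp (prim_popv p RT hn hρ (Primrec.fst.comp ?_)) (Primrec.const 1)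
  refine Primrec.list_foldr (h := fun a (cs : ℕ × (List ℕ × List ℕ)) =>
    (stepS p RT (n a) (ρ a) cs.1 cs.2, cs.2.1)) ht (Primrec.const ([], [])) ?_
  refine Primrec.pair (prim_stepS p RT (hn.comp Primrec.fst) (hρ.comp Primrec.fst)
    (Primrec.fst.comp Primrec.snd) (Primrec.snd.comp Primrec.snd)) ?_
  exact Primrec.fst.comp (Primrec.snd.comp Primrec.snd)

abbrev Inp := (ℕ × List ℕ) × List (ℕ × List ℕ)

theorem prim_Crit (p C : ℕ) (PT : List (List ℕ)) (RT : List (ℕ × List ℕ)) :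
    PrimrecPred (Crit p C PT RT) := by
  have k1 : Primrec fun x : Inp => x.1.1 := Primrec.fst.comp Primrec.fst
  have t1 : Primrec fun x : Inp => x.1.2 := Primrec.snd.comp Primrec.fst
  refine prim_ex (prim_types p C k1) ?_
  have k2 := k1.comp (Primrec.fst (α := Inp) (β := List ℕ))
  have t2 := t1.comp (Primrec.fst (α := Inp) (β := List ℕ))
  have s2 := Primrec.snd (α := Inp) (β := List ℕ)
  refine (prim_Valid p PT k2 s2).and ((prim_Ev p RT k2 s2 t2).and ?_)
  refine prim_ex (prim_tuples (Primrec.const C) (Primrec.list_length.comp (prim_types p C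
    (Primrec.nat_add.comp k2 (Primrec.const p))))) ?_
  have k3 := k2.comp (Primrec.fst (α := Inp × List ℕ) (β := List ℕ))
  have t3 := t2.comp (Primrec.fst (α := Inp × List ℕ) (β := List ℕ))
  have s3 := s2.comp (Primrec.fst (α := Inp × List ℕ) (β := List ℕ))
  have l3 : Primrec fun x : (Inp × List ℕ) × List ℕ => x.1.1.2 :=
    Primrec.snd.comp (Primrec.fst.comp Primrec.fst)
  have B3 := Primrec.snd (α := Inp × List ℕ) (β := List ℕ)
  refine PrimrecPred.and ?_ (PrimrecPred.and ?_ ?_)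
  · refine prim_all (prim_types p C (Primrec.nat_add.comp k3 (Primrec.const p))) ?_
    have k4 := k3.comp (Primrec.fst (α := (Inp × List ℕ) × List ℕ) (β := List ℕ))
    have s4 := s3.comp (Primrec.fst (α := (Inp × List ℕ) × List ℕ) (β := List ℕ))
    have B4 := B3.comp (Primrec.fst (α := (Inp × List ℕ) × List ℕ) (β := List ℕ))
    have r4 := Primrec.snd (α := (Inp × List ℕ) × List ℕ) (β := List ℕ)
    have kp4 := Primrec.nat_add.comp k4 (Primrec.const p)
    refine prim_imp (prim_Valid p PT kp4 r4) (prim_imp ?_ ?_)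
    · exact Primrec.eq.comp (prim_tcomp p kp4 r4 k4 (Primrec.list_range.comp k4)) s4
    · exact prim_mem PT (prim_Bm p C k4 (Primrec.const p) B4 r4)
  · refine prim_all l3 ?_
    have k4 := k3.comp (Primrec.fst (α := (Inp × List ℕ) × List ℕ) (β := ℕ × List ℕ))
    have s4 := s3.comp (Primrec.fst (α := (Inp × List ℕ) × List ℕ) (β := ℕ × List ℕ))
    have B4 := B3.comp (Primrec.fst (α := (Inp × List ℕ) × List ℕ) (β := ℕ × List ℕ))
    have q4 := Primrec.snd (α := (Inp × List ℕ) × List ℕ) (β := ℕ × List ℕ)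
    refine prim_all (prim_types p C (Primrec.nat_add.comp k4 (Primrec.fst.comp q4))) ?_
    have k5 := k4.comp (Primrec.fst (α := ((Inp × List ℕ) × List ℕ) × (ℕ × List ℕ)) (β := List ℕ))
    have s5 := s4.comp (Primrec.fst (α := ((Inp × List ℕ) × List ℕ) × (ℕ × List ℕ)) (β := List ℕ))
    have B5 := B4.comp (Primrec.fst (α := ((Inp × List ℕ) × List ℕ) × (ℕ × List ℕ)) (β := List ℕ))
    have q5 := q4.comp (Primrec.fst (α := ((Inp × List ℕ) × List ℕ) × (ℕ × List ℕ)) (β := List ℕ))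
    have r5 := Primrec.snd (α := ((Inp × List ℕ) × List ℕ) × (ℕ × List ℕ)) (β := List ℕ)
    have m5 := Primrec.fst.comp q5
    have km5 := Primrec.nat_add.comp k5 m5
    refine prim_imp (prim_Valid p PT km5 r5) (prim_imp ?_ (prim_imp ?_ ?_))
    · exact Primrec.eq.comp (prim_tcomp p km5 r5 k5 (Primrec.list_range.comp k5)) s5
    · refine prim_Ev p RT m5 (prim_tcomp p km5 r5 m5 ?_) (Primrec.snd.comp q5)
      exact prim_map (Primrec.list_range.comp m5)
        (Primrec.nat_add.comp (k5.comp Primrec.fst) Primrec.snd)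
    · exact prim_Ev p RT m5 (prim_Bm p C k5 m5 B5 r5) (Primrec.snd.comp q5)
  · refine (prim_Ev p RT k3 (prim_Bm p C k3 k3 B3 (prim_tcomp p k3 s3
      (Primrec.nat_add.comp k3 k3) ?_)) t3).not
    exact Primrec.list_append.comp (Primrec.list_range.comp k3) (Primrec.list_range.comp k3)

theorem prim_NonemptyC (p C : ℕ) (PT : List (List ℕ)) (RT : List (ℕ × List ℕ)) :
    PrimrecPred (NonemptyC p C PT RT) := by
  have k1 : Primrec fun x : Inp => x.1.1 := Primrec.fst.comp Primrec.fst
  have t1 : Primrec fun x : Inp => x.1.2 := Primrec.snd.comp Primrec.fst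
  refine prim_ex (prim_types p C k1) ?_
  have k2 := k1.comp (Primrec.fst (α := Inp) (β := List ℕ))
  have t2 := t1.comp (Primrec.fst (α := Inp) (β := List ℕ))
  have s2 := Primrec.snd (α := Inp) (β := List ℕ)
  exact (prim_Valid p PT k2 s2).and (prim_Ev p RT k2 s2 t2)

theorem prim_ConstC (p C : ℕ) (PT : List (List ℕ)) (RT : List (ℕ × List ℕ)) :
    PrimrecPred (ConstC p C PT RT) := by
  refine prim_ex (prim_types p C (Primrec.const 1)) ?_
  have s2 := Primrec.snd (α := Inp) (β := List ℕ)
  have l2 : Primrec fun x : Inp × List ℕ => x.1.2 := Primrec.snd.comp Primrec.fst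
  refine (prim_Valid p PT (Primrec.const 1) s2).and (prim_all l2 ?_)
  have s3 := s2.comp (Primrec.fst (α := Inp × List ℕ) (β := ℕ × List ℕ))
  have q3 := Primrec.snd (α := Inp × List ℕ) (β := ℕ × List ℕ)
  refine prim_Ev p RT (Primrec.fst.comp q3) (prim_tcomp p (Primrec.const 1) s3
    (Primrec.fst.comp q3) ?_) (Primrec.snd.comp q3)
  exact prim_map (Primrec.list_range.comp (Primrec.fst.comp q3)) (Primrec.const 0)

theorem prim_trx (D : List ℕ) : Primrec (trx D) := by
  refine Primrec.pair Primrec.fst (Primrec.list_append.comp Primrec.snd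
    (Primrec.list_append.comp (prim_map Primrec.snd ?_) (Primrec.const [(2, D)])))
  have h : Primrec fun x : Inp × (ℕ × List ℕ) => x.2.2 := Primrec.snd.comp Primrec.snd
  exact Primrec.pair (Primrec.fst.comp Primrec.snd) (Primrec.list_cons.comp (Primrec.const 3)
    (Primrec.list_append.comp h (Primrec.const [11])))

theorem exists_computable {P : Inp → Prop} (hP : PrimrecPred P) :
    ∃ f : ℕ → Bool, Computable f ∧ ∀ x : Inp, f (Encodable.encode x) = true ↔ P x := by
  obtain ⟨inst, h⟩ := hP
  refine ⟨fun n => (Encodable.decode (α := Inp) n).elim false (fun x => decide (P x)), ?_, ?_⟩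
  · apply Primrec.to_comp
    refine (Primrec.option_casesOn (o := fun n : ℕ => Encodable.decode (α := Inp) n)
      (f := fun _ => false) (g := fun _ x => decide (P x)) Primrec.decode
      (Primrec.const false) (h.comp Primrec.snd)).of_eq ?_
    intro n
    cases Encodable.decode (α := Inp) n <;> rfl
  · intro x
    show ((Encodable.decode (α := Inp) (Encodable.encode x)).elim false
      (fun x => decide (P x))) = true ↔ P x
    rw [Encodable.encodek]
    simp

end Prim

end ExprAux

open FirstOrder FirstOrder.Language
set_option linter.unusedSectionVars false
namespace ExprAux

section Model

/-- the properties of the structure `M` used for the algorithm -/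
structure Good (L : Language) (M : Type) [L.Structure M] (p : ℕ) : Prop where
  p3 : 3 ≤ p
  ar : ∀ (r : ℕ) (_ : L.Relations r), 2 * r ≤ p
  ord : PaperDef.Ordered L M
  hom : L.IsUltrahomogeneous M
  bnd : ∃ (k : ℕ) (F : Fin k → CategoryTheory.Bundled.{0} L.Structure),
    (∀ i, Finite (F i) ∧ Nat.card (F i) ≤ p) ∧
    ∀ A : CategoryTheory.Bundled.{0} L.Structure, Structure.FG L A →
      (A ∈ L.age M ↔ ∀ i, ¬ Nonempty ((F i) ↪[L] A))

variable {L : Language} {M : Type} [L.Structure M] [L.IsRelational]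
  [Finite (Σ i, L.Relations i)] {p : ℕ}

/-- the atomic diagram of a sequence in its initial segments -/
def colorSet (x : ℕ → M) : Set (Σ i, L.Relations i) :=
  {R | Structure.RelMap R.2 (fun i : Fin R.1 => x i)}

variable (L) in
noncomputable def color (x : ℕ → M) : ℕ :=
  (Finite.equivFin (Set (Σ i, L.Relations i)) (colorSet x)).val

variable (L) in
noncomputable def numC : ℕ := Nat.card (Set (Σ i, L.Relations i))

variable (L) in
theorem numC_pos : 0 < numC L := Nat.card_pos

variable (L) in
theorem color_lt (x : ℕ → M) : color L x < numC L := Fin.is_lt _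

theorem color_eq_iff {x y : ℕ → M} : color L x = color L y ↔
    ∀ (r : ℕ) (R : L.Relations r), Structure.RelMap R (fun i : Fin r => x i) ↔
      Structure.RelMap R (fun i : Fin r => y i) := by
  unfold color
  rw [Fin.val_inj, Equiv.apply_eq_iff_eq]
  constructor
  · intro h r R
    have := Set.ext_iff.1 h ⟨r, R⟩
    exact this
  · intro h
    ext ⟨r, R⟩
    exact h r R

theorem color_congr (h : Good L M p) {x y : ℕ → M} (hxy : ∀ i < p, x i = y i) :
    color L x = color L y := by
  rw [color_eq_iff]
  intro r R
  have := h.ar r R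
  have e : (fun i : Fin r => x i) = fun i : Fin r => y i := by
    funext i; exact hxy _ (by have := i.2; omega)
  rw [e]

variable (L p) in
/-- the type of the first `n` entries of a sequence -/
noncomputable def tp (n : ℕ) (x : ℕ → M) : List ℕ :=
  (tuples n p).map (fun e => color L (fun i => x (e.getD i 0)))

theorem tp_mem_types (n : ℕ) (x : ℕ → M) : tp L p n x ∈ types p (numC L) n := by
  rw [types, mem_tuples]
  refine ⟨by simp [tp], ?_⟩
  intro d hd
  simp only [tp, List.mem_map] at hd
  obtain ⟨e, _, rfl⟩ := hd
  exact color_lt L _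

theorem map_range_mem {u : ℕ → ℕ} {n k : ℕ} (h : ∀ i < k, u i < n) :
    (List.range k).map u ∈ tuples n k := by
  rw [mem_tuples]
  refine ⟨by simp, ?_⟩
  intro d hd
  simp only [List.mem_map, List.mem_range] at hd
  obtain ⟨i, hi, rfl⟩ := hd
  exact h i hi

theorem getD_map_range {u : ℕ → ℕ} {k i : ℕ} (h : i < k) : ((List.range k).map u).getD i 0 = u i := by
  rw [List.getD_eq_getElem _ _ (by simpa using h)]
  simp

theorem getD_map' {f : ℕ → ℕ} {w : List ℕ} {i : ℕ} (h : i < w.length) :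
    (w.map f).getD i 0 = f (w.getD i 0) := by
  rw [List.getD_eq_getElem _ _ (by simpa using h), List.getD_eq_getElem _ _ h]
  simp

theorem eq_map_range {w : List ℕ} {k : ℕ} (h : w.length = k) :
    w = (List.range k).map (fun i => w.getD i 0) := by
  apply List.ext_getElem
  · simpa using h
  · intro i h1 h2
    simp [List.getElem?_eq_getElem h1]

theorem tp_eq_iff (h : Good L M p) {n : ℕ} {x y : ℕ → M} : tp L p n x = tp L p n y ↔
    ∀ (r : ℕ) (R : L.Relations r) (v : Fin r → ℕ), (∀ i, v i < n) →
      (Structure.RelMap R (fun i => x (v i)) ↔ Structure.RelMap R (fun i => y (v i))) := by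
  unfold tp
  rw [List.map_inj_left]
  constructor
  · intro H r R v hv
    rcases Nat.eq_zero_or_pos r with rfl | hr
    · have : (fun i => x (v i)) = fun i => y (v i) := Subsingleton.elim _ _
      rw [this]
    · have har := h.ar r R
      have hw := H ((List.range p).map (fun i => v ⟨min i (r - 1), by omega⟩))
        (map_range_mem (fun i _ => hv _))
      rw [color_eq_iff] at hw
      have hw := hw r R
      have e : ∀ z : ℕ → M, (fun i : Fin r => z (((List.range p).map
          (fun i => v ⟨min i (r - 1), by omega⟩)).getD i 0)) = fun i => z (v i) := by
        intro z
        funext i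
        rw [getD_map_range (by omega)]
        congr 2
        ext
        simp
        omega
      rwa [e, e] at hw
  · intro H e he
    rw [color_eq_iff]
    intro r R
    have har := h.ar r R
    exact H r R _ (fun i => getD_lt_of_mem_tuples he (by omega))

theorem tp_congr (h : Good L M p) {n : ℕ} {x y : ℕ → M} (hxy : ∀ i < n, x i = y i) :
    tp L p n x = tp L p n y := by
  rw [tp_eq_iff h]
  intro r R v hv
  have : (fun i => x (v i)) = fun i => y (v i) := by funext i; exact hxy _ (hv i)
  rw [this]

theorem tp_aut (h : Good L M p) (n : ℕ) (x : ℕ → M) (α : M ≃[L] M) :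
    tp L p n (fun i => α (x i)) = tp L p n x := by
  rw [tp_eq_iff h]
  intro r R v _
  exact StrongHomClass.map_rel α R (fun i => x (v i))

theorem exists_ord (h : Good L M p) : ∃ ro : L.Relations 2,
    ∀ a b : M, a = b ↔ Structure.RelMap ro ![a, b] ∧ Structure.RelMap ro ![b, a] := by
  obtain ⟨ro, hro⟩ := h.ord
  refine ⟨ro, fun a b => ⟨?_, ?_⟩⟩
  · rintro rfl
    have := hro.toIsPartialOrder.toIsPreorder.toRefl.refl a
    exact ⟨this, this⟩
  · rintro ⟨h1, h2⟩
    exact hro.toIsPartialOrder.toAntisymm.antisymm a b h1 h2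

theorem tp_eq_eq (h : Good L M p) {n : ℕ} {x y : ℕ → M} (hxy : tp L p n x = tp L p n y)
    {i j : ℕ} (hi : i < n) (hj : j < n) : x i = x j ↔ y i = y j := by
  obtain ⟨ro, hro⟩ := exists_ord h
  rw [tp_eq_iff h] at hxy
  have e : ∀ (z : ℕ → M) (i j : ℕ), (fun k => z ((![i, j] : Fin 2 → ℕ) k)) = ![z i, z j] := by
    intro z i j
    funext k
    fin_cases k <;> rfl
  have h1 := hxy 2 ro ![i, j] (by intro k; fin_cases k <;> assumption)
  have h2 := hxy 2 ro ![j, i] (by intro k; fin_cases k <;> assumption)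
  rw [e, e] at h1 h2
  rw [hro, hro, h1, h2]

variable (L) in
/-- every subset carries a substructure -/
def relSub (s : Set M) : L.Substructure M := ⟨s, fun f => isEmptyElim f⟩

theorem homog_fn (h : Good L M p) (s : Set M) (hs : s.Finite) (f : s → M)
    (hf : Function.Injective f)
    (hr : ∀ (r : ℕ) (R : L.Relations r) (v : Fin r → s),
      Structure.RelMap R (fun i => f (v i)) ↔ Structure.RelMap R (fun i => (v i : M))) :
    ∃ α : M ≃[L] M, ∀ a : s, α a = f a := by
  have hfin : Finite (relSub L s) := hs
  obtain ⟨g, hg⟩ := h.hom (relSub L s) (Substructure.FG.of_finite)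
    { toFun := f, inj' := hf, map_fun' := fun F => isEmptyElim F,
      map_rel' := fun R x => hr _ R x }
  refine ⟨g, fun a => ?_⟩
  exact (DFunLike.congr_fun hg a).symm

theorem homog (h : Good L M p) {n : ℕ} {x y : ℕ → M} (hxy : tp L p n x = tp L p n y) :
    ∃ α : M ≃[L] M, ∀ j < n, α (x j) = y j := by
  have hc : ∀ a : x '' (Set.Iio n), ∃ j, j < n ∧ x j = a := by
    rintro ⟨_, j, hj, rfl⟩; exact ⟨j, hj, rfl⟩
  choose c hc1 hc2 using hc
  obtain ⟨α, hα⟩ := homog_fn h (x '' (Set.Iio n)) ((Set.finite_Iio n).image x)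
    (fun a => y (c a)) (by
      intro a b hab
      have := (tp_eq_eq h hxy (hc1 a) (hc1 b)).2 hab
      rw [hc2, hc2] at this
      exact Subtype.ext this) (by
      intro r R v
      rw [← (tp_eq_iff h).1 hxy r R (fun i => c (v i)) (fun i => hc1 _)]
      simp only [hc2])
  refine ⟨α, fun j hj => ?_⟩
  have := hα ⟨x j, j, hj, rfl⟩
  rw [this]
  exact (tp_eq_eq h hxy (hc1 _) hj).1 (hc2 _)

theorem tcomp_tp (h : Good L M p) {n m : ℕ} {g : List ℕ} (x : ℕ → M)
    (hg : ∀ d < m, g.getD d 0 < n) :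
    tcomp p n (tp L p n x) m g = tp L p m (fun j => x (g.getD j 0)) := by
  unfold tcomp
  conv_rhs => unfold tp
  apply List.map_congr_left
  intro w hw
  have hw' := mem_tuples.1 hw
  rw [tp, app_map]
  · apply color_congr h
    intro i hi
    rw [getD_map' (by omega)]
  · rw [mem_tuples]
    refine ⟨by simpa using hw'.1, ?_⟩
    intro d hd
    rw [List.mem_map] at hd
    obtain ⟨d', hd', rfl⟩ := hd
    exact hg _ (hw'.2 _ hd')

variable (L M p) in
theorem finite_PT : {τ : List ℕ | ∃ y : ℕ → M, tp L p p y = τ}.Finite := by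
  refine (List.finite_toSet (types p (numC L) p)).subset ?_
  rintro _ ⟨y, rfl⟩
  exact tp_mem_types _ _

variable (L M p) in
/-- the list of the realized types of `p`-tuples -/
noncomputable def PT : List (List ℕ) := (finite_PT L M p).toFinset.toList

theorem mem_PT {τ : List ℕ} : τ ∈ PT L M p ↔ ∃ y : ℕ → M, tp L p p y = τ := by
  simp [PT]

theorem valid_tp (h : Good L M p) (n : ℕ) (x : ℕ → M) : Valid p (PT L M p) n (tp L p n x) := by
  intro w hw
  rw [mem_PT, tcomp_tp h x (fun d hd => getD_lt_of_mem_tuples hw hd)]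
  exact ⟨_, rfl⟩

end Model

end ExprAux

open FirstOrder FirstOrder.Language
set_option linter.unusedSectionVars false
namespace ExprAux

section Realize

variable {L : Language} {M : Type} [L.Structure M] [L.IsRelational]
  [Finite (Σ i, L.Relations i)] {p : ℕ}

/-- extension of a tuple to a sequence -/
def extv {X : Type*} (d : X) {r : ℕ} (v : Fin r → X) : ℕ → X :=
  fun i => if h : 0 < r then v ⟨min i (r - 1), by omega⟩ else d

theorem extv_apply {X : Type*} (d : X) {r : ℕ} (v : Fin r → X) (i : Fin r) :
    extv d v i = v i := by
  have := i.2
  rw [extv, dif_pos (by omega)]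
  congr 1
  ext
  simp
  omega

theorem realization_core (h : Good L M p) {n : ℕ} (hn : 0 < n) (y : (ℕ → Fin n) → ℕ → M)
    (hy : ∀ (u : ℕ → Fin n) (e : ℕ → ℕ), (∀ i, e i < p) →
      color L (fun i => y u (e i)) = color L (y (fun i => u (e i)))) :
    ∃ x : Fin n → M, ∀ u : ℕ → Fin n, color L (fun i => x (u i)) = color L (y u) := by
  obtain ⟨ro, hro⟩ := exists_ord h
  have hp := h.p3
  let d : Fin n := ⟨0, hn⟩
  let Q : ∀ {r : ℕ}, L.Relations r → (Fin r → Fin n) → Prop := fun {r} R v =>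
    Structure.RelMap R (fun i : Fin r => y (extv d v) i)
  have K : ∀ (u : ℕ → Fin n) (r : ℕ) (R : L.Relations r) (e : Fin r → ℕ), (∀ i, e i < p) →
      (Structure.RelMap R (fun i => y u (e i)) ↔ Q R (fun i => u (e i))) := by
    intro u r R e he
    show _ ↔ Structure.RelMap R (fun i : Fin r => y (extv d (fun i => u (e i))) i)
    rcases Nat.eq_zero_or_pos r with rfl | hr
    · have : (fun i => y u (e i)) = (fun i : Fin 0 => y (extv d (fun i => u (e i))) i) :=
        Subsingleton.elim _ _
      rw [this]
    · have h1 := hy u (extv 0 e) (by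
        intro i; rw [extv, dif_pos hr]; exact he _)
      have h2 := color_eq_iff.1 h1 r R
      have e1 : (fun i : Fin r => y u (extv 0 e i)) = fun i => y u (e i) := by
        funext i; rw [extv_apply]
      have e2 : (fun i => u (extv 0 e i)) = extv d (fun i => u (e i)) := by
        funext i
        simp [extv, hr]
      rw [e1, e2] at h2
      exact h2
  have e2 : ∀ {X : Type} (z : ℕ → X) (i j : ℕ),
      (fun k => z ((![i, j] : Fin 2 → ℕ) k)) = ![z i, z j] := by
    intro X z i j
    funext k
    fin_cases k <;> rfl
  let E : Fin n → Fin n → Prop := fun a b => Q ro ![a, b] ∧ Q ro ![b, a]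
  have KE : ∀ (u : ℕ → Fin n) (i j : ℕ), i < p → j < p → (E (u i) (u j) ↔ y u i = y u j) := by
    intro u i j hi hj
    rw [hro]
    have h1 := K u 2 ro ![i, j] (by intro k; fin_cases k <;> assumption)
    have h2 := K u 2 ro ![j, i] (by intro k; fin_cases k <;> assumption)
    rw [e2, e2] at h1 h2
    rw [h1, h2]
  have hE : Equivalence E := by
    refine ⟨?_, ?_, ?_⟩
    · intro a
      exact (KE (fun _ => a) 0 0 (by omega) (by omega)).2 rfl
    · intro a b hab
      exact ⟨hab.2, hab.1⟩
    · intro a b c hab hbc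
      let u : ℕ → Fin n := fun i => if i = 0 then a else if i = 1 then b else c
      have h1 := (KE u 0 1 (by omega) (by omega)).1 hab
      have h2 := (KE u 1 2 (by omega) (by omega)).1 hbc
      exact (KE u 0 2 (by omega) (by omega)).2 (h1.trans h2)
  have hcong : ∀ (r : ℕ) (R : L.Relations r) (v v' : Fin r → Fin n), (∀ i, E (v i) (v' i)) →
      (Q R v ↔ Q R v') := by
    intro r R v v' hv
    have har := h.ar r R
    let u : ℕ → Fin n := fun i => if i < r then extv d v i else extv d v' (i - r)
    have h1 := K u r R (fun i => i) (fun i => by have := i.2; omega)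
    have h2 := K u r R (fun i => r + i) (fun i => by have := i.2; omega)
    have u1 : (fun i : Fin r => u i) = v := by
      funext i
      simp only [u]
      rw [if_pos i.2, extv_apply]
    have u2 : (fun i : Fin r => u (r + i)) = v' := by
      funext i
      simp only [u]
      rw [if_neg (by omega), Nat.add_sub_cancel_left, extv_apply]
    rw [u1] at h1
    rw [u2] at h2
    rw [← h1, ← h2]
    have : (fun i : Fin r => y u i) = (fun i : Fin r => y u (r + i)) := by
      funext i
      rw [← KE u i (r + i) (by have := i.2; omega) (by have := i.2; omega)]
      have a1 := congrFun u1 i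
      have a2 := congrFun u2 i
      have a3 := hv i
      rw [← a1, ← a2] at a3
      exact a3
    rw [this]
  let St : Setoid (Fin n) := ⟨E, hE⟩
  let A := Quotient St
  let sA : L.Structure A :=
    { funMap := fun f => isEmptyElim f
      RelMap := fun R q => Q R (fun i => (q i).out) }
  have hA : ∀ (r : ℕ) (R : L.Relations r) (v : Fin r → Fin n),
      Structure.RelMap R (fun i => (Quotient.mk St (v i) : A)) ↔ Q R v := by
    intro r R v
    apply hcong
    intro i
    exact Quotient.mk_out (s := St) (v i)
  obtain ⟨k, F, hF, hage⟩ := h.bnd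
  have hAage : (⟨A, sA⟩ : CategoryTheory.Bundled L.Structure) ∈ L.age M := by
    have : Finite A := Quotient.finite St
    rw [hage _ (show Structure.FG L A from Structure.FG.of_finite)]
    rintro i ⟨e⟩
    obtain ⟨hfin, hcard⟩ := hF i
    let N := Nat.card (F i)
    let en : F i ≃ Fin N := Finite.equivFin (F i)
    let u : ℕ → Fin n := fun j => if hj : j < N then (e (en.symm ⟨j, hj⟩) : A).out else d
    have hu : ∀ f : F i, u (en f) = (e f : A).out := by
      intro f
      simp [u]
    have hlt : ∀ f : F i, (en f : ℕ) < p := fun f => lt_of_lt_of_le (en f).2 hcard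
    have hemb : Nonempty (F i ↪[L] M) := by
      refine ⟨⟨⟨fun f => y u (en f), ?_⟩, fun f => isEmptyElim f, ?_⟩⟩
      · intro f g hfg
        have := (KE u _ _ (hlt f) (hlt g)).2 hfg
        rw [hu, hu] at this
        have h3 : (e f : A) = e g := by
          rw [← Quotient.out_eq (e f : A), ← Quotient.out_eq (e g : A)]
          exact Quotient.sound this
        exact e.injective h3
      · intro r R v
        have h3 := K u r R (fun i => en (v i)) (fun i => hlt _)
        have h4 : (fun i => u (en (v i))) = fun i => (e (v i) : A).out := by
          funext i; exact hu _
        rw [h4] at h3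
        refine h3.trans ?_
        exact StrongHomClass.map_rel e R v
    have hmem : F i ∈ L.age M := ⟨Structure.FG.of_finite, hemb⟩
    exact (hage (F i) Structure.FG.of_finite).1 hmem i ⟨Embedding.refl L _⟩
  obtain ⟨-, ⟨g⟩⟩ := hAage
  refine ⟨fun j => g (Quotient.mk St j : A), fun u => ?_⟩
  rw [color_eq_iff]
  intro r R
  have har := h.ar r R
  have h1 := K u r R (fun i => i) (fun i => by have := i.2; omega)
  rw [h1, ← hA]
  exact StrongHomClass.map_rel g R (fun i : Fin r => (Quotient.mk St (u i) : A))

theorem realization [Nonempty M] (h : Good L M p) {n : ℕ} {ρ : List ℕ}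
    (hρ : ρ ∈ types p (numC L) n) (hv : Valid p (PT L M p) n ρ) :
    ∃ x : ℕ → M, tp L p n x = ρ := by
  have hp := h.p3
  obtain ⟨m0⟩ := ‹Nonempty M›
  have hlen := (mem_tuples.1 hρ).1
  rw [eq_map_app (nodup_tuples n p) hlen]
  unfold tp
  simp only [List.map_inj_left]
  rcases Nat.eq_zero_or_pos n with rfl | hn
  · refine ⟨fun _ => m0, ?_⟩
    intro e he
    have := getD_lt_of_mem_tuples he (i := 0) (by omega)
    omega
  have hvv : ∀ w : List ℕ, ∃ y : ℕ → M, w ∈ tuples n p → tp L p p y = tcomp p n ρ p w := by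
    intro w
    by_cases hw : w ∈ tuples n p
    · obtain ⟨y, hy⟩ := mem_PT.1 (hv w hw)
      exact ⟨y, fun _ => hy⟩
    · exact ⟨fun _ => m0, fun h => absurd h hw⟩
  choose Y hY using hvv
  have hY1 : ∀ (u : ℕ → Fin n) (e : ℕ → ℕ), (∀ i < p, e i < p) →
      color L (fun i => Y ((List.range p).map (fun i => (u i : ℕ))) (e i)) =
        app (tuples n p) ρ ((List.range p).map (fun i => (u (e i) : ℕ))) := by
    intro u e he
    have h1 := hY ((List.range p).map (fun i => (u i : ℕ))) (map_range_mem (fun i _ => (u i).2))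
    unfold tp tcomp at h1
    rw [List.map_inj_left] at h1
    have h2 := h1 ((List.range p).map e) (map_range_mem he)
    rw [List.map_map] at h2
    have h3 : (List.range p).map ((fun d => ((List.range p).map
        (fun i => (u i : ℕ))).getD d 0) ∘ e) = (List.range p).map (fun i => (u (e i) : ℕ)) := by
      apply List.map_congr_left
      intro i hi
      rw [List.mem_range] at hi
      exact getD_map_range (he i hi)
    rw [h3] at h2
    rw [← h2]
    apply color_congr h
    intro i hi
    rw [getD_map_range hi]
  obtain ⟨x, hx⟩ := realization_core h hn (fun u => Y ((List.range p).map (fun i => (u i : ℕ))))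
    (by
      intro u e he
      rw [hY1 u e (fun i _ => he i)]
      exact (hY1 (fun i => u (e i)) id (fun i hi => hi)).symm)
  refine ⟨fun j => if hj : j < n then x ⟨j, hj⟩ else m0, ?_⟩
  intro w hw
  let u : ℕ → Fin n := fun i => if hi : w.getD i 0 < n then ⟨w.getD i 0, hi⟩ else ⟨0, hn⟩
  have h1 := hx u
  have h2 := hY1 u id (fun i hi => hi)
  simp only [id] at h2
  rw [h2] at h1
  have h3 : (List.range p).map (fun i => (u i : ℕ)) = w := by
    conv_rhs => rw [eq_map_range (mem_tuples.1 hw).1]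
    apply List.map_congr_left
    intro i hi
    rw [List.mem_range] at hi
    have := getD_lt_of_mem_tuples hw hi
    simp only [u]
    rw [dif_pos this]
  rw [h3] at h1
  rw [← h1]
  apply color_congr h
  intro i hi
  have := getD_lt_of_mem_tuples hw hi
  simp only [u]
  rw [dif_pos this, dif_pos this]

end Realize

end ExprAux

open FirstOrder FirstOrder.Language
set_option linter.unusedSectionVars false
namespace ExprAux

section Encoding

variable {L' : Language} [∀ i, Encodable (L'.Functions i)] [∀ i, Encodable (L'.Relations i)]

theorem encode_map {α : Type*} [Encodable α] (l : List α) :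
    Encodable.encode l = Encodable.encode (l.map Encodable.encode) := by
  induction l with
  | nil => rfl
  | cons a l ih =>
    rw [List.map_cons, Encodable.encode_list_cons, Encodable.encode_list_cons, ih]
    rfl

/-- the code of a formula -/
def tok {m : ℕ} (φ : L'.Formula (Fin m)) : List ℕ :=
  (BoundedFormula.listEncode φ).map Encodable.encode

def conv (q : PaperDef.FormulaCode L') : ℕ × List ℕ := (q.1, tok q.2)

theorem encode_conv (q : PaperDef.FormulaCode L') :
    Encodable.encode q = Encodable.encode (conv q) := by
  obtain ⟨m, φ⟩ := q
  rw [Encodable.encode_sigma_val, conv, Encodable.encode_prod_val]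
  congr 1
  have : Encodable.encode φ = Encodable.encode (BoundedFormula.listEncode φ) := rfl
  rw [this, encode_map]
  rfl

theorem encode_input (φ₀ : PaperDef.FormulaCode L') (l : List (PaperDef.FormulaCode L')) :
    Encodable.encode (φ₀, l) = Encodable.encode ((conv φ₀, l.map conv) : Inp) := by
  rw [Encodable.encode_prod_val, Encodable.encode_prod_val, encode_conv]
  congr 1
  rw [encode_map, encode_map (l.map conv), List.map_map]
  congr 1
  apply List.map_congr_left
  intro q _
  exact encode_conv q

theorem tok_not {m : ℕ} (φ : L'.Formula (Fin m)) :
    tok (L' := L') (BoundedFormula.not φ : L'.Formula (Fin m)) = 3 :: (tok φ ++ [11]) := by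
  show List.map Encodable.encode ((Sum.inr (Sum.inr 0) :: BoundedFormula.listEncode φ) ++
    [Sum.inr (Sum.inr (0 + 2))]) = _
  rw [List.map_append, List.map_cons]
  rfl

end Encoding

section Eval

variable {L L' : Language} {M : Type} [L.Structure M] [L.IsRelational] [L'.Structure M]
  [Finite (Σ i, L.Relations i)] [Finite (Σ i, L'.Relations i)] {p : ℕ}
  [∀ i, IsEmpty (L'.Functions i)]

variable (L L' M) in
def Inv : Prop := ∀ (α : M ≃[L] M) (r : ℕ) (R : L'.Relations r) (x : Fin r → M),
  Structure.RelMap R (fun i => α (x i)) ↔ Structure.RelMap R x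

theorem inv_of_reduct (h : PaperDef.IsReduct L L' M) : Inv L L' M := by
  intro α r R x
  obtain ⟨φ, hφ⟩ := h r R
  rw [hφ, hφ]
  exact StrongHomClass.realize_formula α φ

theorem inv_formula (h : Inv L L' M) (α : M ≃[L] M) {m : ℕ} (φ : L'.Formula (Fin m))
    (x : Fin m → M) : φ.Realize (fun i => α (x i)) ↔ φ.Realize x := by
  let β : M ≃[L'] M := ⟨α.toEquiv, fun f => isEmptyElim f, fun R x => h α _ R x⟩
  exact StrongHomClass.realize_formula β φ

theorem tcomp_mem_types {C n m : ℕ} {ρ g : List ℕ} (hC : 0 < C) (hρ : ρ ∈ types p C n) :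
    tcomp p n ρ m g ∈ types p C m := by
  rw [types, mem_tuples] at hρ ⊢
  refine ⟨by simp [tcomp], ?_⟩
  intro d hd
  simp only [tcomp, List.mem_map] at hd
  obtain ⟨w, _, rfl⟩ := hd
  exact app_lt hC hρ.2 _

variable [∀ i, Encodable (L'.Relations i)]

variable (L L' M p) in
def RTset : Set (ℕ × List ℕ) :=
  {q | (q.1 = 0 ∧ ∃ y : ℕ → M, tp L p p y = q.2 ∧ y 0 = y 1) ∨
    ∃ R : Σ r, L'.Relations r, q.1 = Encodable.encode R + 1 ∧ q.2 ∈ types p (numC L) p ∧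
      ∃ y : ℕ → M, (tp L p p y = q.2 ∨ R.1 = 0) ∧ Structure.RelMap R.2 (fun i : Fin R.1 => y i)}

variable (L L' M p) in
theorem finite_RT : (RTset L L' M p).Finite := by
  refine Set.Finite.subset (Set.Finite.prod
    ((Set.finite_range (fun R : Σ r, L'.Relations r => Encodable.encode R + 1)).insert 0)
    (List.finite_toSet (types p (numC L) p))) ?_
  rintro ⟨e, τ⟩ (⟨h1, y, h2, -⟩ | ⟨R, h1, h2, -⟩)
  · refine ⟨Or.inl h1, ?_⟩
    simp only at h2
    subst h2
    exact tp_mem_types _ _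
  · exact ⟨Or.inr ⟨R, h1.symm⟩, h2⟩

variable (L L' M p) in
/-- the table for the atomic formulas -/
noncomputable def RT : List (ℕ × List ℕ) := (finite_RT L L' M p).toFinset.toList

theorem mem_RT {q : ℕ × List ℕ} : q ∈ RT L L' M p ↔ q ∈ RTset L L' M p := by
  simp [RT]

theorem padl_tp (h : Good L M p) {n : ℕ} (x : ℕ → M) {l : List ℕ} (hn : 0 < n)
    (hl : ∀ d ∈ l, d < n) : tcomp p n (tp L p n x) p (padl p l) =
      tp L p p (fun j => x (l.getD j 0)) := by
  rw [tcomp_tp h]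
  · apply tp_congr h
    intro i hi
    rw [padl, getD_map_range hi]
  · intro d hd
    rw [padl, getD_map_range hd]
    by_cases hd' : d < l.length
    · rw [List.getD_eq_getElem _ _ hd']; exact hl _ (List.getElem_mem _)
    · rw [List.getD_eq_default _ _ (not_lt.1 hd')]; exact hn

theorem tst_one {n e : ℕ} {ρ l : List ℕ} : tst p (RT L L' M p) n ρ e l = 1 ↔
    (e, tcomp p n ρ p (padl p l)) ∈ RTset L L' M p := by
  rw [← mem_RT, tst]
  split_ifs with H <;> simp [H]

theorem tst_eq (h : Good L M p) {n : ℕ} (x : ℕ → M) {a b : ℕ} (ha : a < n) (hb : b < n) :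
    tst p (RT L L' M p) n (tp L p n x) 0 [a, b] = 1 ↔ x a = x b := by
  have hp := h.p3
  have hl : ∀ d ∈ [a, b], d < n := by simp [ha, hb]
  rw [tst_one, padl_tp h x (by omega) hl]
  constructor
  · rintro (⟨-, y, h1, h2⟩ | ⟨R, h1, -⟩)
    · have h1 : tp L p p y = tp L p p (fun j => x ([a, b].getD j 0)) := h1
      exact (tp_eq_eq h h1 (i := 0) (j := 1) (by omega) (by omega)).1 h2
    · simp at h1
  · intro H
    exact Or.inl ⟨rfl, fun j => x ([a, b].getD j 0), rfl, H⟩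

theorem tst_rel (h : Good L M p) (hi : Inv L L' M) (hp : ∀ r (_ : L'.Relations r), r ≤ p)
    {n : ℕ} (x : ℕ → M) {r : ℕ} (R : L'.Relations r) {l : List ℕ} (hlen : l.length = r)
    (hl : ∀ d ∈ l, d < n) :
    tst p (RT L L' M p) n (tp L p n x) (Encodable.encode (⟨r, R⟩ : Σ r, L'.Relations r) + 1) l = 1
      ↔ Structure.RelMap R (fun i : Fin r => x (l.getD i 0)) := by
  rw [tst_one]
  have key : (Encodable.encode (⟨r, R⟩ : Σ r, L'.Relations r) + 1,
      tcomp p n (tp L p n x) p (padl p l)) ∈ RTset L L' M p ↔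
      Structure.RelMap R (fun i : Fin r => x (l.getD i 0)) := by
    constructor
    · rintro (⟨h1, -⟩ | ⟨R', h1, -, y, h2, h3⟩)
      · simp at h1
      · have h1 : R' = ⟨r, R⟩ := Encodable.encode_injective (Nat.succ_injective h1.symm)
        subst h1
        simp only at h2 h3
        rcases Nat.eq_zero_or_pos r with rfl | hr
        · have : (fun i : Fin 0 => y i) = (fun i : Fin 0 => x (l.getD i 0)) :=
            Subsingleton.elim _ _
          rwa [this] at h3
        · have hn : 0 < n := by
            cases l with
            | nil => simp at hlen; omega
            | cons d l => exact lt_of_le_of_lt (Nat.zero_le _) (hl d (by simp))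
          rw [padl_tp h x hn hl] at h2
          have h2 := h2.resolve_right (by omega)
          obtain ⟨α, hα⟩ := homog h h2
          rw [← hi α] at h3
          have hrp := hp r R
          have : (fun i : Fin r => α (y i)) = (fun i : Fin r => x (l.getD i 0)) := by
            funext i
            exact hα _ (by have := i.2; omega)
          rwa [this] at h3
    · intro H
      refine Or.inr ⟨⟨r, R⟩, rfl, tcomp_mem_types (numC_pos L) (tp_mem_types _ _),
        fun j => x (l.getD j 0), ?_, H⟩
      rcases Nat.eq_zero_or_pos r with hr | hr
      · exact Or.inr hr
      · left
        have hn : 0 < n := by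
          cases l with
          | nil => simp at hlen; omega
          | cons d l => exact lt_of_le_of_lt (Nat.zero_le _) (hl d (by simp))
        exact (padl_tp h x hn hl).symm
  exact key

/-- the variable of an atomic term -/
def vr {m : ℕ} : L'.Term (Fin m ⊕ Fin 0) → Fin m
  | Term.var (Sum.inl j) => j
  | Term.var (Sum.inr j) => j.elim0
  | Term.func f _ => isEmptyElim f

theorem eq_vr {m : ℕ} (t : L'.Term (Fin m ⊕ Fin 0)) : t = Term.var (Sum.inl (vr t)) := by
  cases t with
  | var v =>
    cases v with
    | inl j => rfl
    | inr j => exact j.elim0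
  | func f _ => exact isEmptyElim f

abbrev TokTy (L' : Language) (m : ℕ) :=
  (Σ k, L'.Term (Fin m ⊕ Fin k)) ⊕ ((Σ n, L'.Relations n) ⊕ ℕ)

theorem vdec_tok {m : ℕ} (t : L'.Term (Fin m ⊕ Fin 0)) :
    Encodable.encode (Sum.inl ⟨0, t⟩ : TokTy L' m) % 2 = 0 ∧
    vdec (Encodable.encode (Sum.inl ⟨0, t⟩ : TokTy L' m)) = vr t := by
  have e1 : Encodable.encode (Sum.inl ⟨0, t⟩ : TokTy L' m) =
      2 * Nat.pair 0 (Nat.succ (Nat.pair (2 * (2 * (vr t : ℕ))) 0)) := by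
    conv_lhs => rw [eq_vr t]
    rfl
  rw [e1]
  refine ⟨by simp, ?_⟩
  rw [vdec, Nat.mul_div_cancel_left _ (by norm_num), Nat.unpair_pair, Nat.succ_sub_one,
    Nat.unpair_pair]
  simp only
  omega

theorem run_cons {RTl : List (ℕ × List ℕ)} {n : ℕ} {ρ : List ℕ} (c : ℕ) (rest : List ℕ) :
    run p RTl n ρ (c :: rest) =
      (stepS p RTl n ρ c (run p RTl n ρ rest), (run p RTl n ρ rest).1) := rfl

theorem run_terms {RTl : List (ℕ × List ℕ)} {n m : ℕ} {ρ : List ℕ} (rest : List ℕ)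
    (ts : List (L'.Term (Fin m ⊕ Fin 0))) :
    (run p RTl n ρ ((ts.map (fun t => Encodable.encode (Sum.inl ⟨0, t⟩ : TokTy L' m))) ++
      rest)).1 = ts.map (fun t => (vr t : ℕ) + 2) ++ (run p RTl n ρ rest).1 := by
  induction ts with
  | nil => rfl
  | cons t ts ih =>
    rw [List.map_cons, List.cons_append, run_cons, stepS, if_pos (vdec_tok t).1, (vdec_tok t).2,
      ih]
    rfl

theorem run_tok (h : Good L M p) (hi : Inv L L' M) (hp : ∀ r (_ : L'.Relations r), r ≤ p)
    {n : ℕ} (x : ℕ → M) {φ : L'.Formula (Fin n)} (hφ : BoundedFormula.IsQF φ) :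
    ∀ (rest : List ℕ),
    (popv p (RT L L' M p) n (tp L p n x)
      (run p (RT L L' M p) n (tp L p n x) (tok φ ++ rest)).1 = 1 ↔
        φ.Realize (fun j : Fin n => x j)) ∧
    popr (run p (RT L L' M p) n (tp L p n x) (tok φ ++ rest)).1 =
      (run p (RT L L' M p) n (tp L p n x) rest).1 := by
  have hp0 : ∀ (c : ℕ) (s : List ℕ), c < 2 →
      popv p (RT L L' M p) n (tp L p n x) (c :: s) = c ∧ popr (c :: s) = s := by
    intro c s hc
    simp [popv, popr, hc]
  induction hφ with
  | falsum =>
    intro rest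
    have e : tok (L' := L') (BoundedFormula.falsum : L'.Formula (Fin n)) = [11] := rfl
    rw [e, List.cons_append, run_cons, stepS, if_neg (by norm_num), if_neg (by norm_num),
      if_neg (by norm_num)]
    simp only
    rw [(hp0 0 _ (by norm_num)).1, (hp0 0 _ (by norm_num)).2]
    exact ⟨⟨fun h => by simp at h, fun h => h.elim⟩, rfl⟩
  | of_isAtomic hat =>
    intro rest
    cases hat with
    | equal t₁ t₂ =>
      have e : tok (L' := L') (t₁.bdEqual t₂ : L'.Formula (Fin n)) =
        [t₁, t₂].map (fun t => Encodable.encode (Sum.inl ⟨0, t⟩ : TokTy L' n)) := rfl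
      rw [e, run_terms]
      refine ⟨?_, ?_⟩
      · have : popv p (RT L L' M p) n (tp L p n x)
            (([t₁, t₂].map (fun t => (vr t : ℕ) + 2)) ++
              (run p (RT L L' M p) n (tp L p n x) rest).1) =
            tst p (RT L L' M p) n (tp L p n x) 0 [(vr t₁ : ℕ), (vr t₂ : ℕ)] := by
          simp [popv]
        rw [this, tst_eq h x (vr t₁).2 (vr t₂).2]
        rw [Formula.Realize, BoundedFormula.realize_bdEqual]
        conv_rhs => rw [eq_vr t₁, eq_vr t₂]
        rfl
      · simp [popr]
    | @rel l R ts =>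
      have e : tok (L' := L') (R.boundedFormula ts : L'.Formula (Fin n)) =
        (4 * Encodable.encode (⟨l, R⟩ : Σ r, L'.Relations r) + 1) :: 3 ::
        (((List.finRange l).map ts).map
          (fun t => Encodable.encode (Sum.inl ⟨0, t⟩ : TokTy L' n))) := by
        rw [List.map_map]
        have e0 : BoundedFormula.listEncode (R.boundedFormula ts) =
          [Sum.inr (Sum.inl ⟨_, R⟩), Sum.inr (Sum.inr 0)] ++
            (List.finRange l).map fun i => (Sum.inl ⟨0, ts i⟩ : TokTy L' n) := rfl
        rw [tok, e0, List.map_append, List.map_map]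
        have e1 : Encodable.encode (Sum.inr (Sum.inl ⟨_, R⟩) : TokTy L' n) =
          4 * Encodable.encode (⟨l, R⟩ : Σ r, L'.Relations r) + 1 := by
          rw [Encodable.encode_inr, Encodable.encode_inl]
          ring
        rw [List.map_cons, e1]
        rfl
      rw [e, List.cons_append, List.cons_append, run_cons, run_cons, run_terms]
      generalize hs : stepS p (RT L L' M p) n (tp L p n x) 3 _ = s1
      have hu : (Nat.unpair (Encodable.encode (⟨l, R⟩ : Σ r, L'.Relations r))).1 = l := by
        rw [Encodable.encode_sigma_val, Nat.unpair_pair]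
        rfl
      have hd : (4 * Encodable.encode (⟨l, R⟩ : Σ r, L'.Relations r) + 1) / 4 =
        Encodable.encode (⟨l, R⟩ : Σ r, L'.Relations r) := by omega
      rw [stepS, if_neg (by omega), if_pos (by omega), hd, hu]
      simp only
      have hlen : (List.map (fun t => (vr t : ℕ) + 2) (List.map ts (List.finRange l))).length = l := by
        simp
      rw [List.take_left' hlen, List.drop_left' hlen]
      have hm : List.map (fun d => d - 2)
          (List.map (fun t => (vr t : ℕ) + 2) (List.map ts (List.finRange l))) =
          (List.finRange l).map (fun i => (vr (ts i) : ℕ)) := by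
        rw [List.map_map, List.map_map]
        apply List.map_congr_left
        intro i _
        simp
      rw [hm]
      have ht := tst_rel h hi hp (n := n) x R (l := (List.finRange l).map (fun i => (vr (ts i) : ℕ)))
        (by simp) (by simp)
      have hlt : tst p (RT L L' M p) n (tp L p n x)
        (Encodable.encode (⟨l, R⟩ : Σ r, L'.Relations r) + 1)
          ((List.finRange l).map (fun i => (vr (ts i) : ℕ))) < 2 := by
        unfold tst
        split_ifs <;> norm_num
      rw [(hp0 _ _ hlt).1, (hp0 _ _ hlt).2]
      refine ⟨?_, rfl⟩
      rw [ht, Formula.Realize, BoundedFormula.realize_rel]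
      have : (fun i : Fin l => x (((List.finRange l).map (fun i => (vr (ts i) : ℕ))).getD i 0)) =
          fun i => (ts i).realize (Sum.elim (fun j : Fin n => x j) default) := by
        funext i
        rw [eq_vr (ts i)]
        simp
      rw [this]
  | @imp φ ψ h1 h2 ih1 ih2 =>
    intro rest
    have e : tok (L' := L') (φ.imp ψ : L'.Formula (Fin n)) =
      3 :: (tok (L' := L') φ ++ tok (L' := L') ψ) := by
      have e0 : BoundedFormula.listEncode (φ.imp ψ) =
        (Sum.inr (Sum.inr 0) :: BoundedFormula.listEncode φ) ++ BoundedFormula.listEncode ψ := rfl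
      rw [tok, e0, List.map_append]
      rfl
    rw [e, List.cons_append, List.append_assoc, run_cons, stepS, if_neg (by norm_num),
      if_neg (by norm_num), if_pos rfl]
    obtain ⟨a1, a2⟩ := ih1 (tok (L' := L') ψ ++ rest)
    obtain ⟨b1, b2⟩ := ih2 rest
    simp only
    rw [a2, b2]
    refine ⟨?_, ?_⟩
    · rw [(hp0 _ _ (by split_ifs <;> norm_num)).1]
      rw [Formula.Realize, BoundedFormula.realize_imp]
      rw [Formula.Realize] at a1 b1
      rw [← a1, ← b1]
      split_ifs with H
      · simp only [false_iff]
        exact fun hh => H.2 (hh H.1)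
      · simp only [true_iff]
        intro hh
        by_contra hc
        exact H ⟨hh, hc⟩
    · exact (hp0 _ _ (by split_ifs <;> norm_num)).2

theorem Ev_iff (h : Good L M p) (hi : Inv L L' M) (hp : ∀ r (_ : L'.Relations r), r ≤ p)
    {n : ℕ} (x : ℕ → M) {φ : L'.Formula (Fin n)} (hφ : BoundedFormula.IsQF φ) :
    Ev p (RT L L' M p) n (tp L p n x) (tok φ) ↔ φ.Realize (fun j : Fin n => x j) := by
  have := (run_tok h hi hp x hφ []).1
  rwa [List.append_nil] at this

end Eval

end ExprAux

open FirstOrder FirstOrder.Language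
set_option linter.unusedSectionVars false
namespace ExprAux

section Ramsey

theorem rigid_le {β : Type*} [LinearOrder β] {n : ℕ} (a b : Fin n → β)
    (hr : ∀ i, ∃ j, a j = b i)
    (hab : ∀ i j, a i ≤ a j ↔ b i ≤ b j) (i : Fin n) : a i ≤ b i := by
  have hc : ∀ z : Set.range a, ∃ i, a i = z := fun z => z.2
  choose c hc using hc
  let f : Set.range a → Set.range a := fun z => ⟨b (c z), hr (c z)⟩
  have hf : StrictMono f := by
    intro z w hzw
    rw [← not_le] at hzw ⊢
    intro h
    apply hzw
    have h' : b (c w) ≤ b (c z) := h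
    rw [← hab, hc, hc] at h'
    exact h'
  have h1 := hf.le_apply (x := ⟨a i, i, rfl⟩)
  have h2 : a i ≤ b (c ⟨a i, i, rfl⟩) := h1
  have h3 : b (c ⟨a i, i, rfl⟩) ≤ b i := by
    rw [← hab, hc]
  exact h2.trans h3

theorem rigid {β : Type*} [LinearOrder β] {n : ℕ} (a b : Fin n → β)
    (hr : ∀ i, ∃ j, a j = b i) (hr' : ∀ i, ∃ j, b j = a i)
    (hab : ∀ i j, a i ≤ a j ↔ b i ≤ b j) : a = b := by
  funext i
  exact le_antisymm (rigid_le a b hr hab i) (rigid_le b a hr' (fun i j => (hab i j).symm) i)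

variable {L : Language} {M : Type} [L.Structure M] [L.IsRelational]
  [Finite (Σ i, L.Relations i)] {p : ℕ}

theorem rigid_ord (h : Good L M p) {n : ℕ} (a b : Fin n → M)
    (hr : ∀ i, ∃ j, a j = b i) (hr' : ∀ i, ∃ j, b j = a i)
    (hab : ∀ (r : ℕ) (R : L.Relations r) (v : Fin r → Fin n),
      Structure.RelMap R (fun i => a (v i)) ↔ Structure.RelMap R (fun i => b (v i))) : a = b := by
  obtain ⟨ro, hro⟩ := h.ord
  let _ : LinearOrder M :=
    { le := fun a b => Structure.RelMap ro ![a, b]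
      le_refl := hro.toIsPartialOrder.toIsPreorder.toRefl.refl
      le_trans := hro.toIsPartialOrder.toIsPreorder.toIsTrans.trans
      le_antisymm := hro.toIsPartialOrder.toAntisymm.antisymm
      le_total := hro.toTotal.total
      toDecidableLE := Classical.decRel _ }
  refine rigid a b hr hr' ?_
  intro i j
  have := hab 2 ro ![i, j]
  have e : ∀ z : Fin n → M, (fun k => z ((![i, j] : Fin 2 → Fin n) k)) = ![z i, z j] := by
    intro z
    funext k
    fin_cases k <;> rfl
  rw [e, e] at this
  exact this

theorem ram1 (h : Good L M p) (hram : PaperDef.RamseyClass (L.age M)) (K : ℕ) (hK : 1 ≤ K)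
    {n : ℕ} (H : Set M) (hH : H.Finite) (u : Fin n → M) :
    ∃ S : Set M, S.Finite ∧ ∀ χ : (Fin n → M) → Fin K, ∃ α : M ≃[L] M, (∀ a ∈ H, α a ∈ S) ∧
      ∀ v v' : Fin n → M, (∀ i, v i ∈ H) → (∀ i, v' i ∈ H) → PaperDef.SameOrbit L M u v →
        PaperDef.SameOrbit L M u v' → χ (fun i => α (v i)) = χ (fun i => α (v' i)) := by
  have fH : Finite (relSub L H) := hH
  have fP : Finite (relSub L (Set.range u)) := Set.finite_range u
  have mH : (⟨relSub L H, inferInstance⟩ : CategoryTheory.Bundled L.Structure) ∈ L.age M :=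
    ⟨show Structure.FG L (relSub L H) from Structure.FG.of_finite, ⟨(relSub L H).subtype⟩⟩
  have mP : (⟨relSub L (Set.range u), inferInstance⟩ :
      CategoryTheory.Bundled L.Structure) ∈ L.age M :=
    ⟨show Structure.FG L (relSub L (Set.range u)) from Structure.FG.of_finite,
      ⟨(relSub L (Set.range u)).subtype⟩⟩
  obtain ⟨S0, ⟨hS0, ⟨j⟩⟩, hS⟩ := hram K hK _ mH _ mP
  have fS0 : Finite S0 := Structure.FG.finite hS0
  refine ⟨Set.range j, Set.finite_range j, ?_⟩
  intro χ
  let uP : Fin n → relSub L (Set.range u) := fun i => ⟨u i, i, rfl⟩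
  obtain ⟨e, he⟩ := hS (fun Q => χ (fun i => j ((Classical.choice Q.2) (uP i) : Q.1)))
  let e' : relSub L H ↪[L] S0 := e
  obtain ⟨α, hα⟩ := homog_fn h H hH (fun a => j (e' a)) (fun a b hab =>
    e'.injective (j.injective hab)) (by
      intro r R v
      exact StrongHomClass.map_rel (j.comp e') R v)
  refine ⟨α, fun a ha => ⟨e' ⟨a, ha⟩, (hα ⟨a, ha⟩).symm⟩, ?_⟩
  have key : ∀ v : Fin n → M, (∀ i, v i ∈ H) → PaperDef.SameOrbit L M u v →
      ∃ (Q : L.Substructure S0) (hQ : Nonempty (relSub L (Set.range u) ≃[L] Q)),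
        (Q : Set S0) ⊆ Set.range e' ∧
        χ (fun i => j ((Classical.choice hQ) (uP i) : Q)) = χ (fun i => α (v i)) := by
    rintro v hv ⟨β, hβ⟩
    have hmem : ∀ z : relSub L (Set.range u), β z ∈ H := by
      rintro ⟨_, i, rfl⟩
      show β (u i) ∈ H
      rw [hβ]; exact hv i
    let f0 : relSub L (Set.range u) ↪[L] relSub L H :=
      ⟨⟨fun z => ⟨β z, hmem z⟩, fun z w hzw => Subtype.ext (β.injective (congrArg Subtype.val hzw))⟩,
        fun f => isEmptyElim f, fun R x => StrongHomClass.map_rel β R (fun i => (x i : M))⟩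
    let f : relSub L (Set.range u) ↪[L] S0 := e'.comp f0
    have hfu : ∀ i, j (f (uP i)) = α (v i) := by
      intro i
      have h1 := hα ⟨v i, hv i⟩
      rw [h1]
      have : f0 (uP i) = ⟨v i, hv i⟩ := Subtype.ext (hβ i)
      show j (e' (f0 (uP i))) = _
      rw [this]
      rfl
    refine ⟨f.toHom.range, ⟨f.equivRange⟩, ?_, ?_⟩
    · intro z hz
      obtain ⟨w, hw⟩ := Hom.mem_range.1 hz
      exact ⟨f0 w, hw⟩
    · generalize Classical.choice _ = θ
      congr 1
      apply rigid_ord h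
      · intro i
        have hm : f (uP i) ∈ f.toHom.range := Hom.mem_range.2 ⟨uP i, rfl⟩
        obtain ⟨⟨_, k, rfl⟩, hz⟩ := θ.surjective ⟨_, hm⟩
        refine ⟨k, ?_⟩
        rw [← hfu]
        congr 1
        exact congrArg Subtype.val hz
      · intro i
        obtain ⟨⟨_, k, rfl⟩, hz⟩ := Hom.mem_range.1 (θ (uP i)).2
        refine ⟨k, ?_⟩
        rw [← hfu]
        congr 1
      · intro r R w
        have h1 : Structure.RelMap R (fun i => j (θ (uP (w i)) : S0)) ↔
            Structure.RelMap R (fun i => uP (w i)) :=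
          (StrongHomClass.map_rel j R (fun i => (θ (uP (w i)) : S0))).trans
            (StrongHomClass.map_rel θ R (fun i => uP (w i)))
        have h2 : Structure.RelMap R (fun i => j (f (uP (w i)))) ↔
            Structure.RelMap R (fun i => uP (w i)) :=
          StrongHomClass.map_rel (j.comp f) R (fun i => uP (w i))
        simp only [hfu] at h2
        rw [h1, h2]
  intro v v' hv hv' hvu hvu'
  obtain ⟨Q, hQ, hQ1, hQ2⟩ := key v hv hvu
  obtain ⟨Q', hQ', hQ1', hQ2'⟩ := key v' hv' hvu'
  rw [← hQ2, ← hQ2']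
  exact he ⟨Q, hQ⟩ ⟨Q', hQ'⟩ hQ1 hQ1'

theorem ramList (h : Good L M p) (hram : PaperDef.RamseyClass (L.age M)) (K : ℕ) (hK : 1 ≤ K)
    {n : ℕ} (H : Set M) (hH : H.Finite) (U : List (Fin n → M)) :
    ∃ S : Set M, S.Finite ∧ ∀ χ : (Fin n → M) → Fin K, ∃ α : M ≃[L] M, (∀ a ∈ H, α a ∈ S) ∧
      ∀ u ∈ U, ∀ v v' : Fin n → M, (∀ i, v i ∈ H) → (∀ i, v' i ∈ H) →
        PaperDef.SameOrbit L M u v →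
        PaperDef.SameOrbit L M u v' → χ (fun i => α (v i)) = χ (fun i => α (v' i)) := by
  induction U with
  | nil => exact ⟨H, hH, fun χ => ⟨FirstOrder.Language.Equiv.refl L M, fun a ha => ha, by simp⟩⟩
  | cons u U ih =>
    obtain ⟨S1, hS1, h1⟩ := ih
    obtain ⟨S2, hS2, h2⟩ := ram1 h hram K hK S1 hS1 u
    refine ⟨S2, hS2, fun χ => ?_⟩
    obtain ⟨α2, ha2, hb2⟩ := h2 χ
    obtain ⟨α1, ha1, hb1⟩ := h1 (fun w => χ (fun i => α2 (w i)))
    refine ⟨α2.comp α1, fun a ha => ha2 _ (ha1 a ha), ?_⟩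
    intro w hw v v' hv hv' hvu hvu'
    rw [List.mem_cons] at hw
    rcases hw with rfl | hw
    · obtain ⟨β, hβ⟩ := hvu
      obtain ⟨β', hβ'⟩ := hvu'
      exact hb2 (fun i => α1 (v i)) (fun i => α1 (v' i)) (fun i => ha1 _ (hv i))
        (fun i => ha1 _ (hv' i)) ⟨α1.comp β, fun i => congrArg α1 (hβ i)⟩
        ⟨α1.comp β', fun i => congrArg α1 (hβ' i)⟩
    · exact hb1 w hw v v' hv hv' hvu hvu'

end Ramsey

end ExprAux

open FirstOrder FirstOrder.Language
set_option linter.unusedSectionVars false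
namespace ExprAux

section Canon

variable {L : Language} {M : Type} [L.Structure M] [L.IsRelational]
  [Finite (Σ i, L.Relations i)] {p : ℕ}

/-- concatenation of a `k`-tuple and a sequence -/
def cat (k : ℕ) (t x : ℕ → M) : ℕ → M := fun j => if j < k then t j else x (j - k)

theorem cat_lt {k : ℕ} {t x : ℕ → M} {j : ℕ} (h : j < k) : cat k t x j = t j := if_pos h

theorem cat_add {k : ℕ} {t x : ℕ → M} (j : ℕ) : cat k t x (k + j) = x j := by
  rw [cat, if_neg (by omega), Nat.add_sub_cancel_left]

theorem getD_range_append {k j : ℕ} {w : List ℕ} (hj : j < k + w.length) :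
    (List.range k ++ w).getD j 0 = if j < k then j else w.getD (j - k) 0 := by
  split_ifs with h
  · rw [List.getD_append _ _ _ _ (by simpa using h), List.getD_eq_getElem _ _ (by simpa using h)]
    simp
  · rw [List.getD_append_right _ _ _ _ (by simpa using h)]
    simp

theorem getD_ext {k j : ℕ} {w : List ℕ} (hj : j < k + w.length) :
    (ext k w).getD j 0 = if j < k then j else k + w.getD (j - k) 0 := by
  rw [ext, getD_range_append (by simpa using hj)]
  split_ifs with h
  · rfl
  · exact getD_map' (by omega)

theorem getD_range {k j : ℕ} (h : j < k) : (List.range k).getD j 0 = j := by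
  rw [List.getD_eq_getElem _ _ (by simpa using h)]
  simp

theorem tcomp_initial (h : Good L M p) (k n : ℕ) (t x : ℕ → M) :
    tcomp p (k + n) (tp L p (k + n) (cat k t x)) k (List.range k) = tp L p k t := by
  rw [tcomp_tp h _ (fun d hd => by rw [getD_range hd]; omega)]
  apply tp_congr h
  intro i hi
  rw [getD_range hi, cat_lt hi]

theorem tcomp_suffix (h : Good L M p) (k n : ℕ) (t x : ℕ → M) :
    tcomp p (k + n) (tp L p (k + n) (cat k t x)) n ((List.range n).map (fun d => k + d)) =
      tp L p n x := by
  rw [tcomp_tp h _ (fun d hd => by rw [getD_map_range hd]; omega)]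
  apply tp_congr h
  intro i hi
  rw [getD_map_range hi, cat_add]

theorem tcomp_double (h : Good L M p) (k : ℕ) (t : ℕ → M) :
    tcomp p k (tp L p k t) (k + k) (List.range k ++ List.range k) =
      tp L p (k + k) (cat k t t) := by
  have hd : ∀ d < k + k, (List.range k ++ List.range k).getD d 0 = if d < k then d else d - k := by
    intro d hd
    rw [getD_range_append (by simpa using hd)]
    split_ifs with h
    · rfl
    · exact getD_range (by omega)
  rw [tcomp_tp h _ (fun d hd' => by rw [hd d hd']; split_ifs <;> omega)]
  apply tp_congr h
  intro i hi
  rw [hd i hi, cat]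
  split_ifs <;> rfl

theorem Bm_tp (h : Good L M p) (k m : ℕ) (B : List ℕ) (t x : ℕ → M) :
    Bm p (numC L) k m B (tp L p (k + m) (cat k t x)) = (tuples m p).map (fun w =>
      app (types p (numC L) (k + p)) B (tp L p (k + p) (cat k t (fun j => x (w.getD j 0))))) := by
  unfold Bm
  apply List.map_congr_left
  intro w hw
  have hl : w.length = p := (mem_tuples.1 hw).1
  have hd : ∀ d < k + p, (ext k w).getD d 0 = if d < k then d else k + w.getD (d - k) 0 :=
    fun d hd => getD_ext (by omega)
  congr 1
  rw [tcomp_tp h]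
  · apply tp_congr h
    intro i hi
    rw [hd i hi]
    split_ifs with hik
    · rw [cat_lt hik, cat_lt hik]
    · rw [cat_add, cat, if_neg hik]
  · intro d hd'
    rw [hd d hd']
    split_ifs with hik
    · omega
    · have := getD_lt_of_mem_tuples hw (i := d - k) (by omega)
      omega

theorem Bm_mem_types {k m : ℕ} {B ρ : List ℕ} {C n : ℕ} (hC : 0 < C) (hB : B ∈ tuples C n) :
    Bm p C k m B ρ ∈ types p C m := by
  rw [types, mem_tuples]
  refine ⟨by simp [Bm], ?_⟩
  intro d hd
  simp only [Bm, List.mem_map] at hd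
  obtain ⟨w, _, rfl⟩ := hd
  exact app_lt hC (mem_tuples.1 hB).2 _

theorem tcomp_Bm (h : Good L M p) (k m m' : ℕ) (B : List ℕ) (t x : ℕ → M) (w : List ℕ)
    (hw : ∀ d < m', w.getD d 0 < m) :
    tcomp p m (Bm p (numC L) k m B (tp L p (k + m) (cat k t x))) m' w =
      Bm p (numC L) k m' B (tp L p (k + m') (cat k t (fun j => x (w.getD j 0)))) := by
  rw [Bm_tp h, Bm_tp h, tcomp]
  apply List.map_congr_left
  intro e he
  have he' := mem_tuples.1 he
  rw [app_map]
  · congr 1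
    apply tp_congr h
    intro i hi
    unfold cat
    split_ifs with hik
    · rfl
    · show x _ = x _
      rw [getD_map' (by omega)]
  · rw [mem_tuples]
    refine ⟨by simpa using he'.1, ?_⟩
    intro d hd
    obtain ⟨c, hc, rfl⟩ := List.mem_map.1 hd
    exact hw c (he'.2 c hc)

/-- `g` acts on the set `A` as described by the behaviour `B` -/
def Canon (L : Language) (M : Type) [L.Structure M] [Finite (Σ i, L.Relations i)] (p : ℕ) (k : ℕ)
    (t : ℕ → M) (B : List ℕ) (A : Set M) (g : M → M) : Prop :=
  ∀ (n : ℕ) (u : ℕ → M), (∀ j < n, u j ∈ A) →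
    Bm p (numC L) k n B (tp L p (k + n) (cat k t u)) = tp L p n (fun j => g (u j))

/-- behaviours with consistent images are realised on finite sets -/
theorem canon_of_behaviour [Nonempty M] (h : Good L M p) (k : ℕ) (t : ℕ → M) (B : List ℕ)
    (hB : B ∈ tuples (numC L) (types p (numC L) (k + p)).length)
    (h1 : ∀ x : ℕ → M, Bm p (numC L) k p B (tp L p (k + p) (cat k t x)) ∈ PT L M p)
    (A : Set M) (hA : A.Finite) : ∃ g, Canon L M p k t B A g := by
  classical
  obtain ⟨m, x, hx⟩ : ∃ (m : ℕ) (x : ℕ → M), ∀ a ∈ A, ∃ j < m, x j = a := by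
    have a0 : M := Classical.arbitrary M
    refine ⟨hA.toFinset.toList.length, fun j => hA.toFinset.toList.getD j a0, ?_⟩
    intro a ha
    have : a ∈ hA.toFinset.toList := by simpa using ha
    obtain ⟨j, hj, hja⟩ := List.getElem_of_mem this
    exact ⟨j, hj, by
      show hA.toFinset.toList.getD j a0 = a
      rw [List.getD_eq_getElem _ _ hj]; exact hja⟩
  obtain ⟨y, hy⟩ := realization h (n := m)
    (ρ := Bm p (numC L) k m B (tp L p (k + m) (cat k t x)))
    (Bm_mem_types (numC_pos L) hB) (by
      intro w hw
      rw [tcomp_Bm h k m p B t x w (fun d hd => getD_lt_of_mem_tuples hw hd)]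
      exact h1 _)
  have hx' : ∀ a : M, ∃ j, a ∈ A → j < m ∧ x j = a := by
    intro a
    by_cases ha : a ∈ A
    · obtain ⟨j, hj⟩ := hx a ha
      exact ⟨j, fun _ => hj⟩
    · exact ⟨0, fun h => absurd h ha⟩
  choose idx hidx using hx'
  refine ⟨fun a => y (idx a), ?_⟩
  intro n u hu
  have hw : ∀ d < n, ((List.range n).map (fun j => idx (u j))).getD d 0 = idx (u d) :=
    fun d hd => getD_map_range hd
  have hw' : ∀ d < n, ((List.range n).map (fun j => idx (u j))).getD d 0 < m :=
    fun d hd => by rw [hw d hd]; exact (hidx _ (hu d hd)).1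
  have e := tcomp_Bm h k m n B t x ((List.range n).map (fun j => idx (u j))) hw'
  rw [← hy, tcomp_tp h _ hw'] at e
  have e1 : tp L p (k + n) (cat k t u) = tp L p (k + n)
      (cat k t (fun j => x (((List.range n).map (fun j => idx (u j))).getD j 0))) := by
    apply tp_congr h
    intro i hi
    unfold cat
    split_ifs with hik
    · rfl
    · show u _ = x _
      rw [hw _ (by omega), (hidx _ (hu _ (by omega))).2]
  rw [e1, ← e]
  apply tp_congr h
  intro i hi
  rw [hw i hi]

/-- a finite set realising all types over `t` -/
theorem exists_H [Nonempty M] (h : Good L M p) (k : ℕ) (t : ℕ → M) (n : ℕ) :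
    ∃ H : Set M, H.Finite ∧ ∀ ρ ∈ types p (numC L) (k + n), Valid p (PT L M p) (k + n) ρ →
      tcomp p (k + n) ρ k (List.range k) = tp L p k t →
      ∃ u : ℕ → M, (∀ j < n, u j ∈ H) ∧ tp L p (k + n) (cat k t u) = ρ := by
  have key : ∀ ρ : List ℕ, ∃ u : ℕ → M, ρ ∈ types p (numC L) (k + n) →
      Valid p (PT L M p) (k + n) ρ → tcomp p (k + n) ρ k (List.range k) = tp L p k t →
      tp L p (k + n) (cat k t u) = ρ := by
    intro ρ
    by_cases hρ : ρ ∈ types p (numC L) (k + n) ∧ Valid p (PT L M p) (k + n) ρ ∧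
      tcomp p (k + n) ρ k (List.range k) = tp L p k t
    · obtain ⟨h1, h2, h3⟩ := hρ
      obtain ⟨z, rfl⟩ := realization h h1 h2
      rw [tcomp_tp h _ (fun d hd => by rw [getD_range hd]; omega)] at h3
      obtain ⟨α, hα⟩ := homog h h3
      refine ⟨fun j => α (z (k + j)), fun _ _ _ => ?_⟩
      rw [← tp_aut h (k + n) z α]
      apply tp_congr h
      intro i hi
      unfold cat
      split_ifs with hik
      · rw [← hα i hik, getD_range hik]
      · show α (z _) = α (z _)
        rw [Nat.add_sub_cancel' (by omega)]
    · exact ⟨t, fun a b c => absurd ⟨a, b, c⟩ hρ⟩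
  choose u hu using key
  refine ⟨⋃ ρ ∈ {ρ | ρ ∈ types p (numC L) (k + n)}, u ρ '' Set.Iio n, ?_, ?_⟩
  · exact Set.Finite.biUnion (List.finite_toSet _) (fun ρ _ => (Set.finite_Iio n).image _)
  · intro ρ h1 h2 h3
    refine ⟨u ρ, fun j hj => ?_, hu ρ h1 h2 h3⟩
    exact Set.mem_biUnion (show ρ ∈ {ρ | ρ ∈ types p (numC L) (k + n)} from h1) ⟨j, hj, rfl⟩

/-- canonisation -/
theorem canonise [Nonempty M] (h : Good L M p) (hram : PaperDef.RamseyClass (L.age M)) (k : ℕ)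
    (t : ℕ → M) (H : Set M) (hH : H.Finite) (htH : ∀ i < k, t i ∈ H) :
    ∃ A : Set M, A.Finite ∧ ∀ g : M → M, ∃ α : M ≃[L] M, (∀ a ∈ H, α a ∈ A) ∧
      (∀ i < k, α (t i) = t i) ∧
      ∃ B ∈ tuples (numC L) (types p (numC L) (k + p)).length,
        Canon L M p k t B H (fun a => g (α a)) := by
  classical
  have hz : ∀ τ : List ℕ, ∃ z : ℕ → M, (∃ z' : ℕ → M, tp L p (k + p) z' = τ) → tp L p (k + p) z = τ := by
    intro τ
    by_cases hh : ∃ z' : ℕ → M, tp L p (k + p) z' = τ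
    · obtain ⟨z, hz⟩ := hh
      exact ⟨z, fun _ => hz⟩
    · exact ⟨t, fun h' => absurd h' hh⟩
  choose Z hZ using hz
  obtain ⟨S, hS, hSχ⟩ := ramList h hram (numC L) (numC_pos L) H hH
    ((types p (numC L) (k + p)).map (fun τ => fun i : Fin (k + p) => Z τ i))
  have hAA : ∀ v : Fin k → M, ∃ α : M ≃[L] M, (∃ β : M ≃[L] M, ∀ i : Fin k, β (v i) = t i) →
      ∀ i : Fin k, α (v i) = t i := by
    intro v
    by_cases hh : ∃ β : M ≃[L] M, ∀ i : Fin k, β (v i) = t i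
    · obtain ⟨β, hβ⟩ := hh
      exact ⟨β, fun _ => hβ⟩
    · exact ⟨FirstOrder.Language.Equiv.refl L M, fun h' => absurd h' hh⟩
  choose AA hAA using hAA
  refine ⟨⋃ v ∈ {v : Fin k → M | ∀ i, v i ∈ S}, AA v '' S, ?_, ?_⟩
  · exact Set.Finite.biUnion (Set.Finite.pi' (fun _ => hS)) (fun v _ => hS.image _)
  intro g
  obtain ⟨α, hα1, hα2⟩ := hSχ (fun w => ⟨color L (fun j => if hj : j < p then
    g (AA (fun i => w (Fin.castAdd p i)) (w (Fin.natAdd k ⟨j, hj⟩))) else t 0), color_lt L _⟩)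
  let β : M ≃[L] M := AA (fun i => α (t i))
  have hβ : ∀ i : Fin k, β (α (t i)) = t i :=
    hAA (fun i => α (t i)) ⟨α.symm, fun i => α.symm_apply_apply (t i)⟩
  refine ⟨β.comp α, ?_, fun i hi => hβ ⟨i, hi⟩, ?_⟩
  · intro a ha
    refine Set.mem_biUnion (show (fun i : Fin k => α (t i)) ∈ {v : Fin k → M | ∀ i, v i ∈ S} from
      fun i => hα1 _ (htH i i.2)) ?_
    exact ⟨α a, hα1 a ha, rfl⟩
  have hcol : ∀ u u' : ℕ → M, (∀ j < p, u j ∈ H) → (∀ j < p, u' j ∈ H) →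
      tp L p (k + p) (cat k t u) = tp L p (k + p) (cat k t u') →
      color L (fun j => g (β (α (u j)))) = color L (fun j => g (β (α (u' j)))) := by
    intro u u' hu hu' huu'
    have hcH : ∀ u : ℕ → M, (∀ j < p, u j ∈ H) → ∀ i : Fin (k + p), cat k t u i ∈ H := by
      intro u hu i
      unfold cat
      split_ifs with hik
      · exact htH _ hik
      · exact hu _ (by omega)
    have hsame : ∀ u : ℕ → M, PaperDef.SameOrbit L M
        (fun i : Fin (k + p) => Z (tp L p (k + p) (cat k t u)) i)
        (fun i : Fin (k + p) => cat k t u i) := by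
      intro u
      obtain ⟨γ, hγ⟩ := homog h (hZ (tp L p (k + p) (cat k t u)) ⟨_, rfl⟩)
      exact ⟨γ, fun i => hγ i i.2⟩
    have e := hα2 _ (List.mem_map.2 ⟨tp L p (k + p) (cat k t u), tp_mem_types _ _, rfl⟩)
      (fun i => cat k t u i) (fun i => cat k t u' i) (hcH u hu) (hcH u' hu') (hsame u)
      (by have := hsame u'; rwa [← huu'] at this)
    have e' := congrArg Fin.val e
    simp only at e'
    have hfin : ∀ u : ℕ → M, color L (fun j => if hj : j < p then
        g (AA (fun i => α (cat k t u (Fin.castAdd p i))) (α (cat k t u (Fin.natAdd k ⟨j, hj⟩))))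
          else t 0) = color L (fun j => g (β (α (u j)))) := by
      intro u
      apply color_congr h
      intro j hj
      simp only [hj, dif_pos, Fin.val_castAdd, Fin.val_natAdd, cat_add]
      have : (fun i : Fin k => α (cat k t u i)) = fun i : Fin k => α (t i) := by
        funext i
        rw [cat_lt i.2]
      rw [this]
    rw [← hfin u, ← hfin u']
    exact e'
  let F : List ℕ → ℕ := fun τ => if hh : ∃ u : ℕ → M, (∀ j < p, u j ∈ H) ∧
    tp L p (k + p) (cat k t u) = τ then color L (fun j => g (β (α (hh.choose j)))) else 0
  refine ⟨(types p (numC L) (k + p)).map F, ?_, ?_⟩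
  · rw [mem_tuples]
    refine ⟨by simp, ?_⟩
    intro d hd
    obtain ⟨τ, _, rfl⟩ := List.mem_map.1 hd
    simp only [F]
    split_ifs
    · exact color_lt L _
    · exact numC_pos L
  · intro n u hu
    rw [Bm_tp h, tp]
    apply List.map_congr_left
    intro w hw
    rw [app_map (tp_mem_types _ _)]
    have hh : ∃ u' : ℕ → M, (∀ j < p, u' j ∈ H) ∧
      tp L p (k + p) (cat k t u') = tp L p (k + p) (cat k t (fun j => u (w.getD j 0))) :=
      ⟨_, fun j hj => hu _ (getD_lt_of_mem_tuples hw hj), rfl⟩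
    simp only [F]
    rw [dif_pos hh]
    exact hcol _ _ hh.choose_spec.1 (fun j hj => hu _ (getD_lt_of_mem_tuples hw hj))
      hh.choose_spec.2

end Canon

section Criterion

variable {L L' : Language} {M : Type} [L.Structure M] [L.IsRelational] [L'.Structure M]
  [Finite (Σ i, L.Relations i)] [Finite (Σ i, L'.Relations i)] {p : ℕ}
  [∀ i, IsEmpty (L'.Functions i)] [∀ i, Encodable (L'.Relations i)]

/-- a formula holds for a sequence -/
def holds (q : PaperDef.FormulaCode L') (x : ℕ → M) : Prop :=
  q.2.Realize (fun j : Fin q.1 => x j)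

theorem holds_congr {q : PaperDef.FormulaCode L'} {x y : ℕ → M} (hxy : ∀ j < q.1, x j = y j) :
    holds q x ↔ holds q y := by
  unfold holds
  have : (fun j : Fin q.1 => x j) = fun j : Fin q.1 => y j := by
    funext j; exact hxy j j.2
  rw [this]

/-- a map preserves the formulas from `l` on a set `A` -/
def HomOn (l : List (PaperDef.FormulaCode L')) (A : Set M) (g : M → M) : Prop :=
  ∀ q ∈ l, ∀ x : ℕ → M, (∀ j < q.1, x j ∈ A) → holds q x → holds q (fun j => g (x j))

/-- local preservation of `φ₀` -/
def Sem (M : Type) [L'.Structure M] (φ₀ : PaperDef.FormulaCode L')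
    (l : List (PaperDef.FormulaCode L')) : Prop :=
  ∀ t : ℕ → M, holds φ₀ t → ∃ A : Set M, A.Finite ∧ ∀ g : M → M, HomOn l A g →
    holds φ₀ (fun j => g (t j))

theorem holds_inv (hi : Inv L L' M) (α : M ≃[L] M) (q : PaperDef.FormulaCode L') (x : ℕ → M) :
    holds q (fun j => α (x j)) ↔ holds q x :=
  inv_formula hi α q.2 (fun j : Fin q.1 => x j)

theorem crit_iff [Nonempty M] (h : Good L M p) (hi : Inv L L' M)
    (hp : ∀ r (_ : L'.Relations r), r ≤ p)
    (hram : PaperDef.RamseyClass (L.age M)) (φ₀ : PaperDef.FormulaCode L')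
    (l : List (PaperDef.FormulaCode L')) (hφ₀ : BoundedFormula.IsQF φ₀.2)
    (hl : ∀ q ∈ l, BoundedFormula.IsQF q.2) :
    Crit p (numC L) (PT L M p) (RT L L' M p) (conv φ₀, l.map conv) ↔ ¬ Sem M φ₀ l := by
  have ev : ∀ (q : PaperDef.FormulaCode L') (x : ℕ → M), BoundedFormula.IsQF q.2 →
      (Ev p (RT L L' M p) q.1 (tp L p q.1 x) (tok q.2) ↔ holds q x) :=
    fun q x hq => Ev_iff h hi hp x hq
  obtain ⟨k, φ⟩ := φ₀
  constructor
  · rintro ⟨σ, hσ, hv, hE, B, hB, h1, h2, h3⟩ hsem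
    obtain ⟨t, rfl⟩ := realization h hσ hv
    have hE' := (ev ⟨k, φ⟩ t hφ₀).1 hE
    obtain ⟨A, hA, hA'⟩ := hsem t hE'
    obtain ⟨g, hg⟩ := canon_of_behaviour h k t B hB (fun x => h1 _ (tp_mem_types _ _)
      (valid_tp h _ _) (tcomp_initial h k p t x)) (A ∪ t '' Set.Iio k)
      (hA.union ((Set.finite_Iio k).image t))
    apply h3
    simp only [conv]
    rw [tcomp_double h, hg k t (fun j hj => Or.inr ⟨j, hj, rfl⟩)]
    refine (ev ⟨k, φ⟩ _ hφ₀).2 (hA' g ?_)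
    intro q hq x hx hqx
    have := h2 (conv q) (List.mem_map.2 ⟨q, hq, rfl⟩) (tp L p (k + q.1) (cat k t x))
      (tp_mem_types _ _) (valid_tp h _ _) (tcomp_initial h k q.1 t x)
    simp only [conv] at this
    rw [tcomp_suffix h, hg q.1 x (fun j hj => Or.inl (hx j hj)), ev q _ (hl q hq),
      ev q _ (hl q hq)] at this
    exact this hqx
  · intro hs
    unfold Sem at hs
    push Not at hs
    obtain ⟨t, ht, hs⟩ := hs
    obtain ⟨H, hH, htH, hHp, hHl⟩ : ∃ H : Set M, H.Finite ∧ (∀ i < k, t i ∈ H) ∧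
        (∀ ρ ∈ types p (numC L) (k + p), Valid p (PT L M p) (k + p) ρ →
        tcomp p (k + p) ρ k (List.range k) = tp L p k t →
        ∃ u : ℕ → M, (∀ j < p, u j ∈ H) ∧ tp L p (k + p) (cat k t u) = ρ) ∧
        ∀ q ∈ l, ∀ ρ ∈ types p (numC L) (k + q.1), Valid p (PT L M p) (k + q.1) ρ →
        tcomp p (k + q.1) ρ k (List.range k) = tp L p k t →
        ∃ u : ℕ → M, (∀ j < q.1, u j ∈ H) ∧ tp L p (k + q.1) (cat k t u) = ρ := by
      choose HH hHH1 hHH2 using exists_H h k t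
      refine ⟨t '' Set.Iio k ∪ (HH p ∪ ⋃ q ∈ {q | q ∈ l}, HH q.1), ?_, ?_, ?_, ?_⟩
      · exact ((Set.finite_Iio k).image t).union ((hHH1 p).union
          (Set.Finite.biUnion (List.finite_toSet l) (fun q _ => hHH1 _)))
      · exact fun i hi => Or.inl ⟨i, hi, rfl⟩
      · intro ρ a b c
        obtain ⟨u, hu1, hu2⟩ := hHH2 p ρ a b c
        exact ⟨u, fun j hj => Or.inr (Or.inl (hu1 j hj)), hu2⟩
      · intro q hq ρ a b c
        obtain ⟨u, hu1, hu2⟩ := hHH2 q.1 ρ a b c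
        exact ⟨u, fun j hj => Or.inr (Or.inr (Set.mem_biUnion
          (show q ∈ {q | q ∈ l} from hq) (hu1 j hj))), hu2⟩
    obtain ⟨A, hA, hcan⟩ := canonise h hram k t H hH htH
    obtain ⟨g, hg1, hg2⟩ := hs A hA
    obtain ⟨α, hα1, hα2, B, hB, hcB⟩ := hcan g
    refine ⟨tp L p k t, tp_mem_types _ _, valid_tp h _ _, (ev ⟨k, φ⟩ t hφ₀).2 ht, B, hB, ?_, ?_, ?_⟩
    · intro ρ a b c
      obtain ⟨u, hu, rfl⟩ := hHp ρ a b c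
      simp only [conv]
      rw [hcB p u hu]
      exact mem_PT.2 ⟨_, rfl⟩
    · intro q' hq' ρ a b c
      obtain ⟨q, hq, rfl⟩ := List.mem_map.1 hq'
      obtain ⟨u, hu, rfl⟩ := hHl q hq ρ a b c
      simp only [conv]
      rw [hcB q.1 u hu, tcomp_suffix h, ev q _ (hl q hq), ev q _ (hl q hq)]
      intro hqu
      exact hg1 q hq (fun j => α (u j)) (fun j hj => hα1 _ (hu j hj)) ((holds_inv hi α q u).2 hqu)
    · simp only [conv]
      rw [tcomp_double h, hcB k t htH]
      intro hh
      have hh' := (ev ⟨k, φ⟩ _ hφ₀).1 hh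
      apply hg2
      refine (holds_congr ?_).1 hh'
      intro j hj
      simp only
      rw [hα2 j hj]

theorem nonemptyC_iff [Nonempty M] (h : Good L M p) (hi : Inv L L' M)
    (hp : ∀ r (_ : L'.Relations r), r ≤ p) (φ₀ : PaperDef.FormulaCode L')
    (l : List (PaperDef.FormulaCode L')) (hφ₀ : BoundedFormula.IsQF φ₀.2) :
    NonemptyC p (numC L) (PT L M p) (RT L L' M p) (conv φ₀, l.map conv) ↔
      ∃ t : ℕ → M, holds φ₀ t := by
  constructor
  · rintro ⟨σ, hσ, hv, hE⟩
    obtain ⟨t, rfl⟩ := realization h hσ hv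
    exact ⟨t, (Ev_iff h hi hp t hφ₀).1 hE⟩
  · rintro ⟨t, ht⟩
    exact ⟨_, tp_mem_types _ t, valid_tp h _ _, (Ev_iff h hi hp t hφ₀).2 ht⟩

theorem constC_iff [Nonempty M] (h : Good L M p) (hi : Inv L L' M)
    (hp : ∀ r (_ : L'.Relations r), r ≤ p) (φ₀ : PaperDef.FormulaCode L')
    (l : List (PaperDef.FormulaCode L')) (hl : ∀ q ∈ l, BoundedFormula.IsQF q.2) :
    ConstC p (numC L) (PT L M p) (RT L L' M p) (conv φ₀, l.map conv) ↔
      ∃ a : M, ∀ q ∈ l, holds q (fun _ => a) := by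
  have key : ∀ (t : ℕ → M) (n : ℕ), tcomp p 1 (tp L p 1 t) n ((List.range n).map (fun _ => 0)) =
      tp L p n (fun _ => t 0) := by
    intro t n
    rw [tcomp_tp h _ (fun d hd => by rw [getD_map_range hd]; omega)]
    apply tp_congr h
    intro i hi
    rw [getD_map_range hi]
  constructor
  · rintro ⟨σ, hσ, hv, hE⟩
    obtain ⟨t, rfl⟩ := realization h hσ hv
    refine ⟨t 0, fun q hq => ?_⟩
    have := hE (conv q) (List.mem_map.2 ⟨q, hq, rfl⟩)
    rw [key] at this
    exact (Ev_iff h hi hp _ (hl q hq)).1 this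
  · rintro ⟨a, ha⟩
    refine ⟨_, tp_mem_types 1 (fun _ => a), valid_tp h _ _, ?_⟩
    intro q' hq'
    obtain ⟨q, hq, rfl⟩ := List.mem_map.1 hq'
    rw [key]
    exact (Ev_iff h hi hp _ (hl q hq)).2 (ha q hq)

end Criterion

end ExprAux

open FirstOrder FirstOrder.Language
set_option linter.unusedSectionVars false
namespace ExprAux

section Local

variable {L' : Language} {M : Type} [L'.Structure M] {l : List (PaperDef.FormulaCode L')}

instance instStructOf : (PaperDef.sigOf l).Structure M := PaperDef.structOf M l

theorem HomOn.mono {l : List (PaperDef.FormulaCode L')} {A A' : Set M} {g : M → M} (h : A ⊆ A')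
    (hg : HomOn l A' g) : HomOn l A g :=
  fun q hq x hx => hg q hq x (fun j hj => h (hx j hj))

theorem HomOn.fin [Nonempty M] {l : List (PaperDef.FormulaCode L')} {A : Set M} {g : M → M}
    (hg : HomOn l A g) {q : PaperDef.FormulaCode L'} (hq : q ∈ l) (x : Fin q.1 → M)
    (hx : ∀ j, x j ∈ A) (h : q.2.Realize x) : q.2.Realize (fun j => g (x j)) := by
  let x' : ℕ → M := fun j => if hj : j < q.1 then x ⟨j, hj⟩ else Classical.arbitrary M
  have hx' : ∀ j : Fin q.1, x' j = x j := fun j => dif_pos j.2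
  have e : (fun j : Fin q.1 => x' j) = x := funext hx'
  have := hg q hq x' (fun j hj => by rw [hx' ⟨j, hj⟩]; exact hx _) (by
    show q.2.Realize (fun j : Fin q.1 => x' j)
    rw [e]; exact h)
  have e2 : (fun j : Fin q.1 => g (x' j)) = fun j => g (x j) := by
    funext j; rw [hx']
  have t : q.2.Realize (fun j : Fin q.1 => g (x' j)) := this
  rwa [e2] at t

theorem term_comp {α : Type} (t : (PaperDef.sigOf l).Term α) (v : α → M) (g : M → M) :
    t.realize (fun i => g (v i)) = g (t.realize v) := by
  cases t with
  | var a => rfl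
  | func f _ => exact f.elim

theorem elim_comp {α : Type} {n : ℕ} (v : α → M) (xs : Fin n → M) (g : M → M) :
    (Sum.elim (fun i => g (v i)) (fun i => g (xs i)) : α ⊕ Fin n → M) =
      fun i => g (Sum.elim v xs i) := by
  funext i
  cases i <;> rfl

theorem snoc_comp {n : ℕ} (xs : Fin n → M) (a : M) (g : M → M) :
    (Fin.snoc (fun i => g (xs i)) (g a) : Fin (n + 1) → M) =
      fun i => g ((Fin.snoc xs a : Fin (n + 1) → M) i) := by
  have := Fin.comp_snoc (g := g) (q := xs) (y := a)
  exact this.symm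

theorem ep_local [Nonempty M] {α : Type} {n : ℕ} {ψ : (PaperDef.sigOf l).BoundedFormula α n}
    (hψ : PaperDef.IsExistentialPositive ψ) : ∀ (v : α → M) (xs : Fin n → M), ψ.Realize v xs →
      ∃ A : Set M, A.Finite ∧ ∀ g : M → M, HomOn l A g →
        ψ.Realize (fun i => g (v i)) (fun i => g (xs i)) := by
  induction hψ with
  | atomic hat =>
    intro v xs h
    cases hat with
    | equal t₁ t₂ =>
      refine ⟨∅, Set.finite_empty, fun g _ => ?_⟩
      rw [BoundedFormula.realize_bdEqual] at h ⊢
      rw [elim_comp, term_comp, term_comp, h]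
    | @rel r R ts =>
      refine ⟨Set.range (fun i => (ts i).realize (Sum.elim v xs)), Set.finite_range _, fun g hg => ?_⟩
      rw [BoundedFormula.realize_rel] at h ⊢
      have e : (fun i => (ts i).realize (Sum.elim (fun i => g (v i)) (fun i => g (xs i)))) =
          fun i => g ((ts i).realize (Sum.elim v xs)) := by
        funext i
        rw [elim_comp, term_comp]
      rw [e]
      exact hg.fin (List.get_mem l R.1) _ (fun j => ⟨_, rfl⟩) h
  | inf _ _ ih1 ih2 =>
    intro v xs h
    rw [BoundedFormula.realize_inf] at h
    obtain ⟨A1, hA1, h1⟩ := ih1 v xs h.1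
    obtain ⟨A2, hA2, h2⟩ := ih2 v xs h.2
    refine ⟨A1 ∪ A2, hA1.union hA2, fun g hg => ?_⟩
    rw [BoundedFormula.realize_inf]
    exact ⟨h1 g (hg.mono Set.subset_union_left), h2 g (hg.mono Set.subset_union_right)⟩
  | sup _ _ ih1 ih2 =>
    intro v xs h
    rw [BoundedFormula.realize_sup] at h
    rcases h with h | h
    · obtain ⟨A1, hA1, h1⟩ := ih1 v xs h
      exact ⟨A1, hA1, fun g hg => BoundedFormula.realize_sup.2 (Or.inl (h1 g hg))⟩
    · obtain ⟨A1, hA1, h1⟩ := ih2 v xs h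
      exact ⟨A1, hA1, fun g hg => BoundedFormula.realize_sup.2 (Or.inr (h1 g hg))⟩
  | ex _ ih =>
    intro v xs h
    rw [BoundedFormula.realize_ex] at h
    obtain ⟨a, ha⟩ := h
    obtain ⟨A, hA, h1⟩ := ih v _ ha
    refine ⟨A, hA, fun g hg => ?_⟩
    rw [BoundedFormula.realize_ex]
    refine ⟨g a, ?_⟩
    rw [snoc_comp]
    exact h1 g hg

/-- the formula stating that the two variables are distinct -/
def neF (L' : Language) : PaperDef.FormulaCode L' :=
  ⟨2, BoundedFormula.not ((Term.var (Sum.inl 0)).bdEqual (Term.var (Sum.inl 1)))⟩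

theorem realize_neF (x : Fin 2 → M) : (neF L').2.Realize x ↔ x 0 ≠ x 1 := by
  show ¬ _ ↔ _
  rfl

/-- passing from existential to existential positive instances -/
def trans (l : List (PaperDef.FormulaCode L')) : List (PaperDef.FormulaCode L') :=
  l ++ (l.map (fun q => (⟨q.1, BoundedFormula.not q.2⟩ : PaperDef.FormulaCode L')) ++ [neF L'])

theorem qf_local [Nonempty M] {α : Type} {n : ℕ} {ψ : (PaperDef.sigOf l).BoundedFormula α n}
    (hψ : ψ.IsQF) : ∀ (v : α → M) (xs : Fin n → M),
      ∃ A : Set M, A.Finite ∧ ∀ g : M → M, HomOn (trans l) A g →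
        (ψ.Realize (fun i => g (v i)) (fun i => g (xs i)) ↔ ψ.Realize v xs) := by
  induction hψ with
  | falsum => exact fun v xs => ⟨∅, Set.finite_empty, fun g _ => Iff.rfl⟩
  | of_isAtomic hat =>
    intro v xs
    cases hat with
    | equal t₁ t₂ =>
      refine ⟨{t₁.realize (Sum.elim v xs), t₂.realize (Sum.elim v xs)}, Set.toFinite _,
        fun g hg => ?_⟩
      rw [BoundedFormula.realize_bdEqual, BoundedFormula.realize_bdEqual]
      rw [elim_comp, term_comp, term_comp]
      refine ⟨fun h => ?_, fun h => by rw [h]⟩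
      by_contra hc
      have := hg.fin (q := neF L') (by simp [trans])
        ![t₁.realize (Sum.elim v xs), t₂.realize (Sum.elim v xs)]
        (by
          show ∀ j : Fin 2, _
          intro j
          fin_cases j <;> simp) ((realize_neF _).2 hc)
      exact (realize_neF _).1 this h
    | @rel r R ts =>
      refine ⟨Set.range (fun i => (ts i).realize (Sum.elim v xs)), Set.finite_range _, fun g hg => ?_⟩
      rw [BoundedFormula.realize_rel, BoundedFormula.realize_rel]
      have e : (fun i => (ts i).realize (Sum.elim (fun i => g (v i)) (fun i => g (xs i)))) =
          fun i => g ((ts i).realize (Sum.elim v xs)) := by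
        funext i
        rw [elim_comp, term_comp]
      rw [e]
      constructor
      · intro h
        by_contra hc
        have hm : (⟨(l.get R.1).1, BoundedFormula.not (l.get R.1).2⟩ : PaperDef.FormulaCode L') ∈
            trans l := by
          unfold trans
          refine List.mem_append_right _ (List.mem_append_left _ ?_)
          exact List.mem_map.2 ⟨_, List.get_mem l R.1, rfl⟩
        exact hg.fin hm (fun j => (ts (Fin.cast R.2 j)).realize (Sum.elim v xs))
          (fun j => ⟨_, rfl⟩) hc h
      · intro h
        exact hg.fin (List.mem_append_left _ (List.get_mem l R.1)) _ (fun j => ⟨_, rfl⟩) h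
  | imp _ _ ih1 ih2 =>
    intro v xs
    obtain ⟨A1, hA1, h1⟩ := ih1 v xs
    obtain ⟨A2, hA2, h2⟩ := ih2 v xs
    refine ⟨A1 ∪ A2, hA1.union hA2, fun g hg => ?_⟩
    rw [BoundedFormula.realize_imp, BoundedFormula.realize_imp,
      h1 g (hg.mono Set.subset_union_left), h2 g (hg.mono Set.subset_union_right)]

theorem ex_local [Nonempty M] {α : Type} {n : ℕ} {ψ : (PaperDef.sigOf l).BoundedFormula α n}
    (hψ : PaperDef.IsExistential ψ) : ∀ (v : α → M) (xs : Fin n → M), ψ.Realize v xs →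
      ∃ A : Set M, A.Finite ∧ ∀ g : M → M, HomOn (trans l) A g →
        ψ.Realize (fun i => g (v i)) (fun i => g (xs i)) := by
  induction hψ with
  | of_isQF h =>
    intro v xs hv
    obtain ⟨A, hA, h1⟩ := qf_local h v xs
    exact ⟨A, hA, fun g hg => (h1 g hg).2 hv⟩
  | ex _ ih =>
    intro v xs h
    rw [BoundedFormula.realize_ex] at h
    obtain ⟨a, ha⟩ := h
    obtain ⟨A, hA, h1⟩ := ih v _ ha
    refine ⟨A, hA, fun g hg => ?_⟩
    rw [BoundedFormula.realize_ex]
    refine ⟨g a, ?_⟩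
    rw [snoc_comp]
    exact h1 g hg

/-- constant tuples satisfy all existential positive formulas -/
theorem ep_const {α : Type} {n : ℕ} {ψ : (PaperDef.sigOf l).BoundedFormula α n}
    (hψ : PaperDef.IsExistentialPositive ψ) (a : M)
    (ha : ∀ q ∈ l, q.2.Realize (fun _ => a)) :
    ψ.Realize (fun _ => a) (fun _ => a) := by
  have hterm : ∀ {n : ℕ} (t : (PaperDef.sigOf l).Term (α ⊕ Fin n)),
      t.realize (Sum.elim (fun _ => a) (fun _ => a)) = a := by
    intro n t
    cases t with
    | var b => cases b <;> rfl
    | func f _ => exact f.elim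
  induction hψ with
  | atomic hat =>
    cases hat with
    | equal t₁ t₂ => rw [BoundedFormula.realize_bdEqual, hterm, hterm]
    | @rel r R ts =>
      rw [BoundedFormula.realize_rel]
      simp only [hterm]
      exact ha _ (List.get_mem l R.1)
  | inf _ _ ih1 ih2 => exact BoundedFormula.realize_inf.2 ⟨ih1, ih2⟩
  | sup _ _ ih1 ih2 => exact BoundedFormula.realize_sup.2 (Or.inl ih1)
  | @ex n φ _ ih =>
    rw [BoundedFormula.realize_ex]
    refine ⟨a, ?_⟩
    have : (Fin.snoc (fun _ : Fin n => a) a : Fin (n + 1) → M) = fun _ => a := by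
      funext i
      refine Fin.lastCases ?_ ?_ i
      · simp
      · simp
    rw [this]
    exact ih

end Local

section Build

variable {K : Language} {M : Type} [K.Structure M]

/-- definability by a formula from a class -/
def Dfn (P : ∀ N : ℕ, K.BoundedFormula (Fin k) N → Prop) (N : ℕ)
    (D : (Fin k → M) → (Fin N → M) → Prop) : Prop :=
  ∃ c : K.BoundedFormula (Fin k) N, P N c ∧ ∀ v b, c.Realize v b ↔ D v b

structure Closed {k : ℕ} (P : ∀ N : ℕ, K.BoundedFormula (Fin k) N → Prop) : Prop where
  eq : ∀ N (t₁ t₂ : K.Term (Fin k ⊕ Fin N)), P N (t₁.bdEqual t₂)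
  inf : ∀ N c c', P N c → P N c' → P N (c ⊓ c')
  sup : ∀ N c c', P N c → P N c' → P N (c ⊔ c')

variable {k : ℕ} {P : ∀ N : ℕ, K.BoundedFormula (Fin k) N → Prop} {N : ℕ}

theorem Dfn.congr {D D' : (Fin k → M) → (Fin N → M) → Prop} (h : Dfn P N D)
    (hD : ∀ v b, D v b ↔ D' v b) : Dfn P N D' := by
  obtain ⟨c, hc, h⟩ := h
  exact ⟨c, hc, fun v b => (h v b).trans (hD v b)⟩

theorem Dfn.and (hP : Closed P) {D D' : (Fin k → M) → (Fin N → M) → Prop} (h : Dfn P N D)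
    (h' : Dfn P N D') : Dfn P N (fun v b => D v b ∧ D' v b) := by
  obtain ⟨c, hc, h⟩ := h
  obtain ⟨c', hc', h'⟩ := h'
  refine ⟨c ⊓ c', hP.inf _ _ _ hc hc', fun v b => ?_⟩
  rw [BoundedFormula.realize_inf, h, h']

theorem Dfn.or (hP : Closed P) {D D' : (Fin k → M) → (Fin N → M) → Prop} (h : Dfn P N D)
    (h' : Dfn P N D') : Dfn P N (fun v b => D v b ∨ D' v b) := by
  obtain ⟨c, hc, h⟩ := h
  obtain ⟨c', hc', h'⟩ := h'
  refine ⟨c ⊔ c', hP.sup _ _ _ hc hc', fun v b => ?_⟩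
  rw [BoundedFormula.realize_sup, h, h']

theorem Dfn.true (hP : Closed P) (hN : 0 < N) : Dfn (M := M) P N (fun _ _ => True) :=
  ⟨_, hP.eq N (Term.var (Sum.inr ⟨0, hN⟩)) (Term.var (Sum.inr ⟨0, hN⟩)), fun v b => by
    rw [BoundedFormula.realize_bdEqual]; simp⟩

theorem Dfn.eq (hP : Closed P) (i : Fin k) (j : Fin N) :
    Dfn (M := M) P N (fun v b => v i = b j) :=
  ⟨_, hP.eq N (Term.var (Sum.inl i)) (Term.var (Sum.inr j)), fun v b => by
    rw [BoundedFormula.realize_bdEqual]; rfl⟩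

theorem Dfn.all (hP : Closed P) (hN : 0 < N) {ι : Type*} (s : List ι)
    {D : ι → (Fin k → M) → (Fin N → M) → Prop} (h : ∀ i ∈ s, Dfn P N (D i)) :
    Dfn P N (fun v b => ∀ i ∈ s, D i v b) := by
  induction s with
  | nil => exact (Dfn.true hP hN).congr (by simp)
  | cons i s ih =>
    exact ((h i (by simp)).and hP (ih (fun j hj => h j (by simp [hj])))).congr (by simp)

theorem Dfn.allF (hP : Closed P) (hN : 0 < N) {ι : Type*} [Finite ι]
    {D : ι → (Fin k → M) → (Fin N → M) → Prop} (h : ∀ i, Dfn P N (D i)) :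
    Dfn P N (fun v b => ∀ i, D i v b) := by
  have := Fintype.ofFinite ι
  exact (Dfn.all hP hN (Finset.univ : Finset ι).toList (fun i _ => h i)).congr (by simp)

theorem Dfn.exi (hP : Closed P) {ι : Type*} (s : List ι) (hs : s ≠ [])
    {D : ι → (Fin k → M) → (Fin N → M) → Prop} (h : ∀ i ∈ s, Dfn P N (D i)) :
    Dfn P N (fun v b => ∃ i ∈ s, D i v b) := by
  induction s with
  | nil => exact absurd rfl hs
  | cons i s ih =>
    by_cases hs' : s = []
    · subst hs'
      exact (h i (by simp)).congr (by simp)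
    · exact ((h i (by simp)).or hP (ih hs' (fun j hj => h j (by simp [hj])))).congr (by simp)

end Build

section Main

variable {L L' : Language} {M : Type} [L.Structure M] [L.IsRelational] [L'.Structure M]
  [Finite (Σ i, L.Relations i)] [Finite (Σ i, L'.Relations i)] {p : ℕ}
  [∀ i, IsEmpty (L'.Functions i)]

theorem build [Nonempty M] (h : Good L M p) (hi : Inv L L' M) {K : Language} [K.Structure M]
    (φ₀ : PaperDef.FormulaCode L') (ls : List (PaperDef.FormulaCode L'))
    {P : ∀ N : ℕ, K.BoundedFormula (Fin φ₀.1) N → Prop} (hP : Closed P)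
    (hsem : Sem M φ₀ ls) (hne : ∃ t : ℕ → M, holds φ₀ t)
    (hls : ∀ q ∈ ls, ∀ (N : ℕ) (γ : Fin q.1 → Fin N),
      Dfn (M := M) P N (fun _ b => q.2.Realize (fun i => b (γ i)))) :
    ∃ (N : ℕ) (ψ : K.BoundedFormula (Fin φ₀.1) N), P N ψ ∧
      ∀ v : Fin φ₀.1 → M, φ₀.2.Realize v ↔ ∃ b : Fin N → M, ψ.Realize v b := by
  classical
  have a0 : M := Classical.arbitrary M
  let ss : List (List ℕ) := (types p (numC L) φ₀.1).filter
    (fun σ => ∃ t : ℕ → M, tp L p φ₀.1 t = σ ∧ holds φ₀ t)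
  have hss : ∀ σ, σ ∈ ss ↔ ∃ t : ℕ → M, tp L p φ₀.1 t = σ ∧ holds φ₀ t := by
    intro σ
    simp only [ss, List.mem_filter, decide_eq_true_eq]
    constructor
    · exact fun hh => hh.2
    · rintro ⟨t, rfl, ht⟩
      exact ⟨tp_mem_types _ _, t, rfl, ht⟩
  have hT : ∀ σ, ∃ (t : ℕ → M) (A : Set M), A.Finite ∧ (σ ∈ ss → tp L p φ₀.1 t = σ ∧
      ∀ g : M → M, HomOn ls A g → holds φ₀ (fun j => g (t j))) := by
    intro σ
    by_cases hσ : σ ∈ ss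
    · obtain ⟨t, ht, ht'⟩ := (hss σ).1 hσ
      obtain ⟨A, hA, hA'⟩ := hsem t ht'
      exact ⟨t, A, hA, fun _ => ⟨ht, hA'⟩⟩
    · exact ⟨fun _ => a0, ∅, Set.finite_empty, fun hh => absurd hh hσ⟩
  choose T A hA hTA using hT
  let A' : Set M := {a0} ∪ ⋃ σ ∈ {σ | σ ∈ ss}, (A σ ∪ T σ '' Set.Iio φ₀.1)
  have hA' : A'.Finite := (Set.finite_singleton a0).union (Set.Finite.biUnion (List.finite_toSet ss)
    (fun σ _ => (hA σ).union ((Set.finite_Iio _).image _)))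
  have hAA' : ∀ σ ∈ ss, A σ ⊆ A' := by
    intro σ hσ a ha
    exact Or.inr (Set.mem_biUnion (show σ ∈ {σ | σ ∈ ss} from hσ) (Or.inl ha))
  have hTA' : ∀ σ ∈ ss, ∀ i < φ₀.1, T σ i ∈ A' := by
    intro σ hσ i hi
    exact Or.inr (Set.mem_biUnion (show σ ∈ {σ | σ ∈ ss} from hσ) (Or.inr ⟨i, hi, rfl⟩))
  have : Finite A' := hA'
  obtain ⟨N, ⟨e⟩⟩ := Finite.exists_equiv_fin A'
  let a : Fin N → M := fun j => e.symm j
  have ha : Function.Injective a := fun i j hij => e.symm.injective (Subtype.ext hij)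
  let idx : M → Fin N := fun z => if hz : z ∈ A' then e ⟨z, hz⟩ else e ⟨a0, Or.inl rfl⟩
  have hidx : ∀ z ∈ A', a (idx z) = z := by
    intro z hz
    simp [a, idx, hz]
  have hN : 0 < N := (Nat.zero_le _).trans_lt (idx a0).2
  have hssne : ss ≠ [] := by
    obtain ⟨t, ht⟩ := hne
    exact List.ne_nil_of_mem ((hss _).2 ⟨t, rfl, ht⟩)
  have hD : Dfn (M := M) P N (fun v b => ∃ σ ∈ ss, (∀ i : Fin φ₀.1, v i = b (idx (T σ i))) ∧
      ∀ q ∈ ls, ∀ γ : Fin q.1 → Fin N, q.2.Realize (fun i => a (γ i)) →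
        q.2.Realize (fun i => b (γ i))) := by
    refine Dfn.exi hP ss hssne (fun σ _ => Dfn.and hP (Dfn.allF hP hN (fun i => Dfn.eq hP _ _)) ?_)
    refine Dfn.all hP hN ls (fun q hq => Dfn.allF hP hN (fun γ => ?_))
    by_cases hc : q.2.Realize (fun i => a (γ i))
    · exact (hls q hq N γ).congr (by simp [hc])
    · exact (Dfn.true hP hN).congr (by simp [hc])
  obtain ⟨ψ, hψ, hψ'⟩ := hD
  refine ⟨N, ψ, hψ, fun v => ?_⟩
  simp only [hψ']
  constructor
  · intro hv
    let t : ℕ → M := fun j => if hj : j < φ₀.1 then v ⟨j, hj⟩ else a0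
    have ht : ∀ j : Fin φ₀.1, t j = v j := fun j => dif_pos j.2
    have htv : (fun j : Fin φ₀.1 => t j) = v := funext ht
    have hσ : tp L p φ₀.1 t ∈ ss := (hss _).2 ⟨t, rfl, by
      show φ₀.2.Realize (fun j : Fin φ₀.1 => t j)
      rw [htv]; exact hv⟩
    obtain ⟨α, hα⟩ := homog h (hTA _ hσ).1
    refine ⟨fun j => α (a j), _, hσ, fun i => ?_, fun q _ γ hq => ?_⟩
    · show v i = α (a _)
      rw [hidx _ (hTA' _ hσ i i.2), hα i i.2, ht]
    · exact (inv_formula hi α q.2 (fun i => a (γ i))).2 hq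
  · rintro ⟨b, σ, hσ, hv, hb⟩
    have hg := (hTA σ hσ).2 (fun z => b (idx z)) (by
      intro q hq x hx hqx
      have hx' : ∀ j < q.1, a (idx (x j)) = x j := fun j hj => hidx _ (hAA' σ hσ (hx j hj))
      refine hb q hq (fun j => idx (x j)) ?_
      have : (fun j : Fin q.1 => a (idx (x j))) = fun j : Fin q.1 => x j := by
        funext j; exact hx' j j.2
      rw [this]
      exact hqx)
    have : v = fun j : Fin φ₀.1 => b (idx (T σ j)) := funext hv
    rw [this]
    exact hg

theorem ep_exs {K : Language} {α : Type} {n : ℕ} {ψ : K.BoundedFormula α n}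
    (h : PaperDef.IsExistentialPositive ψ) : PaperDef.IsExistentialPositive ψ.exs := by
  induction n with
  | zero => exact h
  | succ n ih => exact ih (PaperDef.IsExistentialPositive.ex h)

theorem ex_exs {K : Language} {α : Type} {n : ℕ} {ψ : K.BoundedFormula α n}
    (h : PaperDef.IsExistential ψ) : PaperDef.IsExistential ψ.exs := by
  induction n with
  | zero => exact h
  | succ n ih => exact ih (PaperDef.IsExistential.ex h)

theorem closed_ep (K : Language) (k : ℕ) :
    Closed (K := K) (k := k) (fun _ c => PaperDef.IsExistentialPositive c) :=
  ⟨fun _ _ _ => .atomic (.equal _ _), fun _ _ _ => .inf, fun _ _ _ => .sup⟩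

theorem closed_qf (K : Language) (k : ℕ) :
    Closed (K := K) (k := k) (fun _ c => c.IsQF) :=
  ⟨fun _ _ _ => .of_isAtomic (.equal _ _), fun _ _ _ h h' => h.inf h', fun _ _ _ h h' => h.sup h'⟩

/-- the atomic formula of a relation -/
def atm (l : List (PaperDef.FormulaCode L')) (k N : ℕ) (i : Fin l.length)
    (γ : Fin (l.get i).1 → Fin N) : (PaperDef.sigOf l).BoundedFormula (Fin k) N :=
  Relations.boundedFormula (L := PaperDef.sigOf l) (n := (l.get i).1) ⟨i, rfl⟩
    (fun j => Term.var (Sum.inr (γ j)))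

theorem realize_atm (l : List (PaperDef.FormulaCode L')) (k N : ℕ) (i : Fin l.length)
    (γ : Fin (l.get i).1 → Fin N) (v : Fin k → M) (b : Fin N → M) :
    (atm l k N i γ).Realize v b ↔ (l.get i).2.Realize (fun j => b (γ j)) := by
  exact Iff.rfl

theorem atm_atomic (l : List (PaperDef.FormulaCode L')) (k N : ℕ) (i : Fin l.length)
    (γ : Fin (l.get i).1 → Fin N) : (atm l k N i γ).IsAtomic :=
  BoundedFormula.IsAtomic.rel _ _

theorem dfn_ep (l : List (PaperDef.FormulaCode L')) (k : ℕ) :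
    ∀ q ∈ l, ∀ (N : ℕ) (γ : Fin q.1 → Fin N),
      Dfn (K := PaperDef.sigOf l) (k := k) (M := M)
        (fun _ c => PaperDef.IsExistentialPositive c) N
        (fun _ b => q.2.Realize (fun i => b (γ i))) := by
  intro q hq N γ
  obtain ⟨i, rfl⟩ := List.get_of_mem hq
  exact ⟨atm l k N i γ, .atomic (atm_atomic l k N i γ), fun v b => realize_atm l k N i γ v b⟩

theorem dfn_qf (l : List (PaperDef.FormulaCode L')) (k : ℕ) :
    ∀ q ∈ trans l, ∀ (N : ℕ) (γ : Fin q.1 → Fin N),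
      Dfn (K := PaperDef.sigOf l) (k := k) (M := M) (fun _ c => c.IsQF) N
        (fun _ b => q.2.Realize (fun i => b (γ i))) := by
  intro q hq N γ
  rw [trans, List.mem_append, List.mem_append, List.mem_map, List.mem_singleton] at hq
  rcases hq with hq | ⟨q', hq', rfl⟩ | rfl
  · obtain ⟨i, rfl⟩ := List.get_of_mem hq
    exact ⟨atm l k N i γ, .of_isAtomic (atm_atomic l k N i γ),
      fun v b => realize_atm l k N i γ v b⟩
  · obtain ⟨i, rfl⟩ := List.get_of_mem hq'
    exact ⟨(atm l k N i γ).not, (BoundedFormula.IsQF.of_isAtomic (atm_atomic l k N i γ)).not,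
      fun v b => not_congr (realize_atm l k N i γ v b)⟩
  · refine ⟨BoundedFormula.not ((Term.var (Sum.inr (γ (0 : Fin 2)))).bdEqual
      (Term.var (Sum.inr (γ (1 : Fin 2))))),
      (BoundedFormula.IsQF.of_isAtomic (.equal _ _)).not, fun v b => ?_⟩
    exact Iff.rfl

theorem fin_to_nat [Nonempty M] {k : ℕ} (v : Fin k → M) : ∃ t : ℕ → M,
    (fun j : Fin k => t j) = v :=
  ⟨fun j => if hj : j < k then v ⟨j, hj⟩ else Classical.arbitrary M, funext fun j => dif_pos j.2⟩

theorem ep_iff [Nonempty M] (h : Good L M p) (hi : Inv L L' M)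
    (φ₀ : PaperDef.FormulaCode L') (l : List (PaperDef.FormulaCode L')) :
    PaperDef.ExprYesEP M φ₀ l ↔ Sem M φ₀ l ∧
      ((∃ t : ℕ → M, holds φ₀ t) ∨ ¬ ∃ a : M, ∀ q ∈ l, holds q (fun _ => a)) := by
  constructor
  · rintro ⟨ψ, hψ, hφ⟩
    refine ⟨?_, ?_⟩
    · intro t ht
      obtain ⟨A, hA, hA'⟩ := ep_local hψ _ _ ((hφ _).1 ht)
      refine ⟨A, hA, fun g hg => ?_⟩
      refine (hφ _).2 ?_
      have := hA' g hg
      rw [Subsingleton.elim (fun i => g ((default : Fin 0 → M) i)) default] at this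
      exact this
    · by_contra hc
      push Not at hc
      obtain ⟨h1, a, ha⟩ := hc
      apply h1 (fun _ => a)
      refine (hφ _).2 ?_
      have := ep_const hψ a ha
      rw [Subsingleton.elim (fun _ : Fin 0 => a) default] at this
      exact this
  · rintro ⟨hsem, hor⟩
    by_cases hne : ∃ t : ℕ → M, holds φ₀ t
    · obtain ⟨N, ψ, hψ, hv⟩ := build h hi (K := PaperDef.sigOf l) φ₀ l (closed_ep _ φ₀.1) hsem hne
        (dfn_ep l φ₀.1)
      refine ⟨ψ.exs, ep_exs hψ, fun v => ?_⟩
      rw [hv]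
      exact BoundedFormula.realize_exs.symm
    · have hor := hor.resolve_left hne
      obtain ⟨ψ, hψ, hv⟩ := Dfn.all (K := PaperDef.sigOf l) (M := M) (closed_ep _ φ₀.1)
        (N := 1) one_pos l (fun q hq => dfn_ep l φ₀.1 q hq 1 (fun _ => 0))
      refine ⟨ψ.exs, ep_exs hψ, fun v => ?_⟩
      refine Iff.trans ?_ BoundedFormula.realize_exs.symm
      constructor
      · intro hh
        obtain ⟨t, ht⟩ := fin_to_nat v
        exact absurd ⟨t, show φ₀.2.Realize (fun j : Fin φ₀.1 => t j) by rw [ht]; exact hh⟩ hne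
      · rintro ⟨b, hb⟩
        exact absurd ⟨b 0, (hv v b).1 hb⟩ hor

theorem ex_iff [Nonempty M] (h : Good L M p) (hi : Inv L L' M)
    (φ₀ : PaperDef.FormulaCode L') (l : List (PaperDef.FormulaCode L')) :
    PaperDef.ExprYesEx M φ₀ l ↔ Sem M φ₀ (trans l) := by
  constructor
  · rintro ⟨ψ, hψ, hφ⟩
    intro t ht
    obtain ⟨A, hA, hA'⟩ := ex_local hψ _ _ ((hφ _).1 ht)
    refine ⟨A, hA, fun g hg => ?_⟩
    refine (hφ _).2 ?_
    have := hA' g hg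
    rw [Subsingleton.elim (fun i => g ((default : Fin 0 → M) i)) default] at this
    exact this
  · intro hsem
    by_cases hne : ∃ t : ℕ → M, holds φ₀ t
    · obtain ⟨N, ψ, hψ, hv⟩ := build h hi (K := PaperDef.sigOf l) φ₀ (trans l) (closed_qf _ φ₀.1)
        hsem hne (dfn_qf l φ₀.1)
      refine ⟨ψ.exs, ex_exs (.of_isQF hψ), fun v => ?_⟩
      rw [hv]
      exact BoundedFormula.realize_exs.symm
    · refine ⟨BoundedFormula.falsum, .of_isQF .falsum, fun v => ⟨fun hh => ?_, fun hh => hh.elim⟩⟩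
      obtain ⟨t, ht⟩ := fin_to_nat v
      exact absurd ⟨t, show φ₀.2.Realize (fun j : Fin φ₀.1 => t j) by rw [ht]; exact hh⟩ hne

theorem trans_qf {l : List (PaperDef.FormulaCode L')} (hl : ∀ q ∈ l, BoundedFormula.IsQF q.2) :
    ∀ q ∈ trans l, BoundedFormula.IsQF q.2 := by
  intro q hq
  rw [trans, List.mem_append, List.mem_append, List.mem_map, List.mem_singleton] at hq
  rcases hq with hq | ⟨q', hq', rfl⟩ | rfl
  · exact hl q hq
  · exact (hl q' hq').not
  · exact (BoundedFormula.IsQF.of_isAtomic (.equal _ _)).not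

theorem conv_trans [∀ i, Encodable (L'.Relations i)] (φ₀ : PaperDef.FormulaCode L')
    (l : List (PaperDef.FormulaCode L')) :
    ((conv φ₀, (trans l).map conv) : Inp) = trx (tok (neF L').2) (conv φ₀, l.map conv) := by
  unfold trx trans
  rw [List.map_append, List.map_append, List.map_map, List.map_map]
  congr 3
  apply List.map_congr_left
  intro q _
  show (q.1, tok (BoundedFormula.not q.2)) = _
  rw [tok_not]
  rfl

theorem main_aux [Nonempty M] [∀ i, Encodable (L'.Relations i)] (h : Good L M p) (hi : Inv L L' M)
    (hp : ∀ r (_ : L'.Relations r), r ≤ p) (hram : PaperDef.RamseyClass (L.age M)) :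
    PaperDef.DecidableExprEx L' M ∧ PaperDef.DecidableExprEP L' M := by
  constructor
  · obtain ⟨f, hf, hf'⟩ := exists_computable
      ((prim_Crit p (numC L) (PT L M p) (RT L L' M p)).comp (prim_trx (tok (neF L').2))).not
    refine ⟨f, hf, fun φ₀ l hφ₀ hl => ?_⟩
    rw [encode_input, hf', ← conv_trans, crit_iff h hi hp hram φ₀ _ hφ₀ (trans_qf hl), not_not,
      ex_iff h hi]
  · obtain ⟨f, hf, hf'⟩ := exists_computable
      ((prim_Crit p (numC L) (PT L M p) (RT L L' M p)).not.and
        ((prim_NonemptyC p (numC L) (PT L M p) (RT L L' M p)).or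
          (prim_ConstC p (numC L) (PT L M p) (RT L L' M p)).not))
    refine ⟨f, hf, fun φ₀ l hφ₀ hl => ?_⟩
    rw [encode_input, hf', crit_iff h hi hp hram φ₀ _ hφ₀ hl, not_not,
      nonemptyC_iff h hi hp φ₀ l hφ₀, constC_iff h hi hp φ₀ l hl, ep_iff h hi]

end Main

theorem exists_good (L L' : Language) (M : Type) [L.Structure M] [L.IsRelational]
    (hLfin : Finite (Σ i, L.Relations i)) (hL'fin : Finite (Σ i, L'.Relations i))
    (hord : PaperDef.Ordered L M) (hhom : L.IsUltrahomogeneous M)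
    (hfb : PaperDef.FinitelyBounded L M) :
    ∃ p, Good L M p ∧ ∀ r (_ : L'.Relations r), r ≤ p := by
  obtain ⟨k, F, hF, hF'⟩ := hfb
  obtain ⟨b1, hb1⟩ := (Set.finite_range (fun R : Σ i, L.Relations i => R.1)).bddAbove
  obtain ⟨b2, hb2⟩ := (Set.finite_range (fun R : Σ i, L'.Relations i => R.1)).bddAbove
  obtain ⟨b3, hb3⟩ := (Set.finite_range (fun i : Fin k => Nat.card (F i))).bddAbove
  refine ⟨3 + 2 * b1 + b2 + b3, ⟨by omega, ?_, hord, hhom, k, F, ?_, hF'⟩, ?_⟩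
  · intro r R
    have : r ≤ b1 := hb1 ⟨⟨r, R⟩, rfl⟩
    omega
  · intro i
    refine ⟨Structure.FG.finite (hF i), ?_⟩
    have : Nat.card (F i) ≤ b3 := hb3 ⟨i, rfl⟩
    omega
  · intro r R
    have : r ≤ b2 := hb2 ⟨⟨r, R⟩, rfl⟩
    omega

end ExprAux

namespace PaperDef
/-- **Theorem 2 of the paper.**  Let `Δ` (an `L`-structure on `M`) be a countably infinite
structure with finite relational signature that is ordered, homogeneous, Ramsey and finitely
bounded, and let `Γ` (an `L'`-structure on `M`) be a reduct of `Δ` with finite relational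
signature.  Then the problems `Expr_ex(Γ)` and `Expr_ep(Γ)` are decidable. -/
theorem decidability_of_Expr_ex_and_Expr_ep
    (L L' : Language) (M : Type) [L.Structure M] [L'.Structure M]
    [Countable M] [Infinite M]
    [∀ i, IsEmpty (L'.Functions i)] [∀ i, Encodable (L'.Relations i)]
    (hLrel : ∀ i, IsEmpty (L.Functions i)) (hLfin : Finite (Σ i, L.Relations i))
    (hL'fin : Finite (Σ i, L'.Relations i))
    (hord : Ordered L M) (hhom : L.IsUltrahomogeneous M)
    (hram : RamseyClass (L.age M)) (hfb : FinitelyBounded L M)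
    (hred : IsReduct L L' M) :
    DecidableExprEx L' M ∧ DecidableExprEP L' M := by
  have : L.IsRelational := hLrel
  have := hLfin
  have := hL'fin
  obtain ⟨p, hg, hp⟩ := ExprAux.exists_good L L' M hLfin hL'fin hord hhom hfb
  exact ExprAux.main_aux hg (ExprAux.inv_of_reduct hred) hp hram

end PaperDef
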